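/- Let X be a smooth affine complex algebraic variety and W a Zariski open subset of X. Then the ring O_X(W) of regular functions on W is Noetherian. -/

import Mathlib

open AlgebraicGeometry Opposite

lemma aux_dim_le {A D : Type} [CommRing A] [CommRing D] [Algebra A D]
    [Algebra.IsIntegral A D] (hinj : Function.Injective (algebraMap A D)) :
    ringKrullDim A ≤ ringKrullDim D := by
  unfold ringKrullDim Order.krullDim
  refine iSup_le fun l => ?_
  obtain ⟨P, hP, hP2⟩ := Ideal.exists_ideal_over_prime_of_isIntegral (R := A) (S := D)
    l.head.asIdeal ⊥ (by
      intro x hx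
      have : algebraMap A D x = 0 := by simpa using hx
      rw [(injective_iff_map_eq_zero _).1 hinj x this]; exact zero_mem _)
  obtain ⟨hp, hover⟩ := hP2
  have : P.LiesOver l.head.asIdeal := ⟨hover.symm⟩
  obtain ⟨L, hL, -⟩ := Ideal.exists_ltSeries_of_hasGoingUp l P
  rw [← hL]
  exact le_iSup (fun p : LTSeries (PrimeSpectrum D) => (p.length : WithBot ℕ∞)) L

/-- growth bound -/
lemma aux_growth {K : Type} [Field K] {k : Type} [Field k] [Algebra k K] {r : ℕ}
    (σ : Fin r → K) (y : K) (hy : IsIntegral (Algebra.adjoin k (Set.range σ)) y) :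
    ∃ e : ℕ, ∀ (V : ValuationSubring K) (w : K), (∀ c : k, algebraMap k K c ∈ V) →
      1 ≤ V.valuation w → (∀ i, V.valuation (σ i) ≤ V.valuation w) →
      V.valuation y ≤ V.valuation w ^ e := by
  have key : ∀ z ∈ Algebra.adjoin k (Set.range σ),
      ∃ e : ℕ, ∀ (V : ValuationSubring K) (w : K), (∀ c : k, algebraMap k K c ∈ V) →
      1 ≤ V.valuation w → (∀ i, V.valuation (σ i) ≤ V.valuation w) →
      V.valuation z ≤ V.valuation w ^ e := by
    intro z hz
    induction hz using Algebra.adjoin_induction with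
    | mem x hx =>
      obtain ⟨i, rfl⟩ := hx
      exact ⟨1, fun V w _ _ h => by simpa using h i⟩
    | algebraMap c =>
      exact ⟨0, fun V w hc _ _ => by simpa using (V.valuation_le_one_iff _).2 (hc c)⟩
    | add x y _ _ hx hy =>
      obtain ⟨a, ha⟩ := hx
      obtain ⟨b, hb⟩ := hy
      refine ⟨a + b, fun V w hc h1 hw => (V.valuation.map_add _ _).trans (max_le ?_ ?_)⟩
      · exact (ha V w hc h1 hw).trans (pow_le_pow_right₀ h1 (by omega))
      · exact (hb V w hc h1 hw).trans (pow_le_pow_right₀ h1 (by omega))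
    | mul x y _ _ hx hy =>
      obtain ⟨a, ha⟩ := hx
      obtain ⟨b, hb⟩ := hy
      refine ⟨a + b, fun V w hc h1 hw => ?_⟩
      rw [map_mul, pow_add]
      exact mul_le_mul' (ha V w hc h1 hw) (hb V w hc h1 hw)
  obtain ⟨f, hf, hfy⟩ := hy
  choose E hE using fun i : ℕ => key (f.coeff i) (f.coeff i).2
  refine ⟨∑ i ∈ Finset.range (f.natDegree + 1), E i, fun V w hc h1 hw => ?_⟩
  set e := ∑ i ∈ Finset.range (f.natDegree + 1), E i with he
  by_contra! hlt
  have hpe : 1 ≤ V.valuation w ^ e := one_le_pow₀ h1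
  have hy1 : 1 < V.valuation y := hpe.trans_lt hlt
  have hy0 : 0 < V.valuation y := zero_lt_one.trans hy1
  have hcoef : ∀ i ∈ Finset.range (f.natDegree + 1),
      V.valuation (f.coeff i : K) < V.valuation y := fun i hi =>
    ((hE i V w hc h1 hw).trans (pow_le_pow_right₀ h1
      (Finset.single_le_sum (f := E) (fun _ _ => Nat.zero_le _) hi))).trans_lt hlt
  rw [Polynomial.eval₂_eq_sum_range, Finset.sum_range_succ] at hfy
  have hlead : f.coeff f.natDegree = 1 := hf
  rw [hlead, map_one, one_mul] at hfy
  have hyd : y ^ f.natDegree = - ∑ i ∈ Finset.range f.natDegree,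
      (algebraMap (Algebra.adjoin k (Set.range σ)) K) (f.coeff i) * y ^ i :=
    eq_neg_of_add_eq_zero_right hfy
  have h2 : V.valuation (y ^ f.natDegree) < V.valuation (y ^ f.natDegree) := by
    conv_lhs => rw [hyd, Valuation.map_neg]
    refine V.valuation.map_sum_lt (by simpa using fun h => absurd h (by intro h; simp [h] at hy0)) ?_
    intro i hi
    have hi' := Finset.mem_range.1 hi
    rw [map_mul, map_pow, map_pow]
    calc _ < V.valuation y * V.valuation y ^ i := by
            refine mul_lt_mul_of_pos_right (hcoef i (Finset.mem_range.2 (by omega))) ?_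
            exact pow_pos hy0 i
      _ = V.valuation y ^ (i+1) := by rw [pow_succ']
      _ ≤ _ := pow_le_pow_right₀ hy1.le hi'
  exact lt_irrefl _ h2

lemma aux_integral {K : Type} [Field K] {k : Type} [Field k] [Algebra k K] {r : ℕ}
    (σ u : Fin r → K) (hu : ∀ i, IsIntegral (Algebra.adjoin k (Set.range σ)) (u i)) :
    ∃ M : ℕ, 2 ≤ M ∧ ∀ i,
      IsIntegral (Algebra.adjoin k (Set.range fun i => u i + σ i ^ M)) (σ i) := by
  choose E hE using fun i => aux_growth (k := k) σ (u i) (hu i)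
  refine ⟨(∑ i, E i) + 2, by omega, fun i => ?_⟩
  set M := (∑ i, E i) + 2 with hM
  set S := Algebra.adjoin k (Set.range fun i => u i + σ i ^ M) with hS
  have hmem : σ i ∈ (integralClosure (Subring.closure (S : Set K)) K).toSubring := by
    rw [← iInf_valuationSubring_superset]
    rw [Subring.mem_iInf]
    rintro ⟨V, hV⟩
    have hc : ∀ c : k, algebraMap k K c ∈ V := fun c => hV (S.algebraMap_mem c)
    have ht : ∀ j, u j + σ j ^ M ∈ V := fun j => hV (Algebra.subset_adjoin ⟨j, rfl⟩)
    change σ i ∈ V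
    by_contra hi
    have : Nonempty (Fin r) := ⟨i⟩
    obtain ⟨j, hj⟩ := Finite.exists_max (fun j => V.valuation (σ j))
    have hi1 : 1 < V.valuation (σ i) := by
      rw [← V.valuation_le_one_iff] at hi; exact not_le.1 hi
    have hj1 : 1 < V.valuation (σ j) := hi1.trans_le (hj i)
    have h1 := hE j V (σ j) hc hj1.le hj
    have h2 : V.valuation (u j) < V.valuation (σ j ^ M) := by
      rw [map_pow]
      refine h1.trans_lt (pow_lt_pow_right₀ hj1 ?_)
      have := Finset.single_le_sum (f := E) (fun _ _ => Nat.zero_le _) (Finset.mem_univ j)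
      omega
    have h3 := (V.valuation_le_one_iff _).2 (ht j)
    rw [Valuation.map_add_eq_of_lt_right _ h2, map_pow] at h3
    exact absurd h3 (not_le.2 (one_lt_pow₀ hj1 (by omega)))
  have h4 : IsIntegral (Subring.closure (S : Set K)) (σ i) := hmem
  obtain ⟨f, hf, hf0⟩ := h4
  have hle : Subring.closure (S : Set K) ≤ S.toSubring := Subring.closure_le.2 (fun _ h => h)
  refine ⟨f.map (Subring.inclusion hle), hf.map _, ?_⟩
  rw [Polynomial.eval₂_map]
  exact hf0

lemma aux_local {C A : Type} [CommRing C] [CommRing A] [IsLocalRing A] [IsNoetherianRing A]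
    [Algebra C A] [Algebra.FormallyUnramified C A] (p : Ideal A) (hp : p ≠ ⊤)
    (hs : Function.Surjective (algebraMap C (A ⧸ p))) (f : C)
    (hf : RingHom.ker (algebraMap C (A ⧸ p)) = Ideal.span {f}) :
    p = Ideal.span {algebraMap C A f} := by
  have hfp : algebraMap C A f ∈ p := by
    have : f ∈ RingHom.ker (algebraMap C (A ⧸ p)) := by
      rw [hf]; exact Ideal.mem_span_singleton_self f
    rw [RingHom.mem_ker, IsScalarTower.algebraMap_apply C A (A ⧸ p)] at this
    exact Ideal.Quotient.eq_zero_iff_mem.1 this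
  let I : Ideal A := Ideal.span {algebraMap C A f} ⊔ p ^ 2
  have hIp : I ≤ p := sup_le ((Ideal.span_singleton_le_iff_mem _).2 hfp) (Ideal.pow_le_self two_ne_zero)
  let π : A →ₐ[C] A ⧸ I := Ideal.Quotient.mkₐ C I
  let e := Ideal.quotientKerAlgEquivOfSurjective (f := Algebra.ofId C (A ⧸ p)) hs
  let τ : (C ⧸ RingHom.ker (Algebra.ofId C (A ⧸ p))) →ₐ[C] A ⧸ I :=
    Ideal.Quotient.liftₐ _ (Algebra.ofId C (A ⧸ I)) (by
      intro a ha
      have ha' : a ∈ Ideal.span {f} := by rw [← hf]; exact ha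
      obtain ⟨c, rfl⟩ := Ideal.mem_span_singleton'.1 ha'
      have : algebraMap C (A ⧸ I) (c * f) = 0 := by
        rw [IsScalarTower.algebraMap_apply C A (A ⧸ I), map_mul]
        refine Ideal.Quotient.eq_zero_iff_mem.2 (I.mul_mem_left _ ?_)
        exact Ideal.mem_sup_left (Ideal.mem_span_singleton_self _)
      exact this)
  let σ : A →ₐ[C] A ⧸ I := (τ.comp e.symm.toAlgHom).comp (Ideal.Quotient.mkₐ C p)
  have hσπ : π = σ := by
    let J : Ideal (A ⧸ I) := p.map (Ideal.Quotient.mk I)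
    have hJ : J ^ 2 = ⊥ := by
      rw [← Ideal.map_pow, Ideal.map_eq_bot_iff_le_ker, Ideal.mk_ker]
      exact le_sup_right
    refine Algebra.FormallyUnramified.ext J ⟨2, hJ⟩ (fun x => ?_)
    obtain ⟨c, hc⟩ := hs (Ideal.Quotient.mk p x)
    have h1 : σ x = algebraMap C (A ⧸ I) c := by
      change τ (e.symm (Ideal.Quotient.mk p x)) = _
      rw [← hc, AlgEquiv.commutes, AlgHom.commutes]
    rw [h1, IsScalarTower.algebraMap_apply C A (A ⧸ I)]
    refine Ideal.Quotient.eq.2 ?_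
    change Ideal.Quotient.mk I x - Ideal.Quotient.mk I (algebraMap C A c) ∈ _
    rw [← map_sub]
    refine Ideal.mem_map_of_mem _ ?_
    rw [← Ideal.Quotient.eq, ← hc]
    rfl
  have hle : p ≤ I := by
    intro x hx
    rw [← Ideal.Quotient.eq_zero_iff_mem]
    have : π x = σ x := by rw [hσπ]
    change π x = 0
    rw [this]
    change τ (e.symm (Ideal.Quotient.mk p x)) = 0
    rw [Ideal.Quotient.eq_zero_iff_mem.2 hx, map_zero, map_zero]
  refine le_antisymm ?_ ((Ideal.span_singleton_le_iff_mem _).2 hfp)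
  refine Submodule.le_of_le_smul_of_le_jacobson_bot (I := p) (IsNoetherian.noetherian p) ?_ ?_
  · rw [IsLocalRing.jacobson_eq_maximalIdeal _ bot_ne_top]
    exact IsLocalRing.le_maximalIdeal hp
  · simpa [I, pow_two] using hle

open scoped TensorProduct

lemma aux_unram {B A : Type} [CommRing B] [CommRing A] [IsLocalRing A] [Algebra B A]
    [Algebra.EssFiniteType B A] {ι : Type} (t : ι → B)
    (hres : ∀ x : A, ∃ b : B, x - algebraMap B A b ∈ IsLocalRing.maximalIdeal A)
    (ht : IsLocalRing.maximalIdeal A = Ideal.span (Set.range fun i => algebraMap B A (t i))) :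
    Algebra.FormallyUnramified B A := by
  rw [Algebra.formallyUnramified_iff]
  have key : (⊤ : Submodule A (Ω[A⁄B])) ≤ IsLocalRing.maximalIdeal A • (⊤ : Submodule A (Ω[A⁄B])) := by
    rw [← KaehlerDifferential.span_range_derivation, Submodule.span_le]
    rintro _ ⟨x, rfl⟩
    obtain ⟨b, hb⟩ := hres x
    have h1 : KaehlerDifferential.D B A x = KaehlerDifferential.D B A (x - algebraMap B A b) := by
      simp
    rw [h1]
    generalize x - algebraMap B A b = y at hb
    have hb' := hb
    rw [ht] at hb'
    rw [KaehlerDifferential.span_range_derivation]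
    refine Submodule.span_induction (p := fun y _ => KaehlerDifferential.D B A y ∈ (IsLocalRing.maximalIdeal A • (⊤ : Submodule A (Ω[A⁄B])) : Submodule A (Ω[A⁄B]))) ?_ ?_ ?_ ?_ hb'
    · rintro _ ⟨i, rfl⟩
      simp
    · simp
    · intro y z _ _ h1 h2
      rw [map_add]
      exact add_mem h1 h2
    · intro a y hy h1
      rw [smul_eq_mul, Derivation.leibniz]
      refine add_mem (Submodule.smul_mem _ _ h1) (Submodule.smul_mem_smul ?_ trivial)
      rw [ht]; exact hy
  have h0 := Submodule.eq_bot_of_le_smul_of_le_jacobson_bot (IsLocalRing.maximalIdeal A)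
    (⊤ : Submodule A (Ω[A⁄B])) (Module.Finite.fg_top) key (IsLocalRing.maximalIdeal_le_jacobson _)
  exact (Submodule.subsingleton_iff A).mp (subsingleton_of_bot_eq_top h0.symm)

lemma aux_etale {k A : Type} [Field k] [CommRing A] [Nontrivial A] [Algebra k A] {n : ℕ}
    [Algebra (MvPolynomial (Fin n) k) A] [IsScalarTower k (MvPolynomial (Fin n) k) A]
    [Algebra.FormallySmooth k A] [Module.Free A (Ω[A⁄k])] [Module.Finite A (Ω[A⁄k])]
    (hn : Module.finrank A (Ω[A⁄k]) = n)
    [Algebra.FormallyUnramified (MvPolynomial (Fin n) k) A] :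
    Algebra.FormallySmooth (MvPolynomial (Fin n) k) A := by
  have hsurj : Function.Surjective (KaehlerDifferential.mapBaseChange k (MvPolynomial (Fin n) k) A) := by
    intro x
    refine (KaehlerDifferential.exact_mapBaseChange_map k (MvPolynomial (Fin n) k) A x).mp ?_
    have : Subsingleton (Ω[A⁄(MvPolynomial (Fin n) k)]) := inferInstance
    exact Subsingleton.elim _ _
  let b1 := (KaehlerDifferential.mvPolynomialBasis k (Fin n)).baseChange A
  let b2 := (Module.finBasisOfFinrankEq A (Ω[A⁄k]) hn)
  let e := b2.equiv b1 (Equiv.refl _)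
  have hinj : Function.Injective (KaehlerDifferential.mapBaseChange k (MvPolynomial (Fin n) k) A) := by
    have hf : Function.Surjective ((KaehlerDifferential.mapBaseChange k (MvPolynomial (Fin n) k) A) ∘ₗ e.toLinearMap) := by
      simpa using hsurj
    have := OrzechProperty.injective_of_surjective_endomorphism _ hf
    simpa using this
  have hH : Subsingleton (Algebra.H1Cotangent (MvPolynomial (Fin n) k) A) := by
    refine subsingleton_of_forall_eq 0 fun x => ?_
    have h1 : Algebra.H1Cotangent.δ k (MvPolynomial (Fin n) k) A x = 0 := by
      apply hinj
      rw [map_zero]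
      exact (Algebra.H1Cotangent.exact_δ_mapBaseChange k (MvPolynomial (Fin n) k) A).apply_apply_eq_zero x
    obtain ⟨y, rfl⟩ := (Algebra.H1Cotangent.exact_map_δ k (MvPolynomial (Fin n) k) A x).mp h1
    have : Subsingleton (Algebra.H1Cotangent k A) := inferInstance
    rw [Subsingleton.elim y 0, map_zero]
  refine ⟨?_, hH⟩
  have : Subsingleton (Ω[A⁄(MvPolynomial (Fin n) k)]) := inferInstance
  infer_instance

lemma aux_flat {B R : Type} [CommRing B] [IsNoetherianRing B] [CommRing R] [Algebra B R]
    [Algebra.FiniteType B R] (m : Ideal R) [m.IsPrime]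
    [Algebra.FormallySmooth B (Localization.AtPrime m)] :
    Module.Flat B (Localization.AtPrime m) := by
  obtain ⟨k, f, hf⟩ := (Algebra.FiniteType.iff_quotient_mvPolynomial'' (R := B) (S := R)).mp inferInstance
  let I : Ideal (MvPolynomial (Fin k) B) := m.comap f.toRingHom
  let g : Localization.AtPrime I →+* Localization.AtPrime m :=
    Localization.localRingHom I m f.toRingHom rfl
  let g' : Localization.AtPrime I →ₐ[B] Localization.AtPrime m :=
    { g with
      commutes' := by
        intro r
        have := Localization.localRingHom_to_map I m f.toRingHom rfl (algebraMap B _ r)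
        simp only [AlgHom.toRingHom_eq_coe, RingHom.coe_coe, AlgHom.commutes] at this
        rw [← IsScalarTower.algebraMap_apply, ← IsScalarTower.algebraMap_apply] at this
        exact this }
  have : Module.Flat B (Localization.AtPrime I) :=
    .trans _ (MvPolynomial (Fin k) B) _
  have : IsNoetherianRing (Localization.AtPrime I) := IsLocalization.isNoetherianRing I.primeCompl _ inferInstance
  refine Algebra.FormallySmooth.flat_of_algHom_of_isNoetherianRing g' ?_
  exact RingHom.surjective_localRingHom_of_surjective f.toRingHom hf m 

open scoped TensorProduct

lemma aux_rank {k R : Type} [Field k] [CommRing R] [IsDomain R] [Algebra k R]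
    [Algebra.FiniteType k R] [Algebra.FormallySmooth k R] (m : Ideal R) [m.IsPrime] :
    Module.Finite (Localization.AtPrime m) (Ω[Localization.AtPrime m⁄k]) ∧
    Module.Free (Localization.AtPrime m) (Ω[Localization.AtPrime m⁄k]) ∧
    Module.finrank (Localization.AtPrime m) (Ω[Localization.AtPrime m⁄k])
      = Module.finrank R (Ω[R⁄k]) := by
  have := Algebra.FormallyEtale.of_isLocalization (Rₘ := Localization.AtPrime m) m.primeCompl
  let e := KaehlerDifferential.tensorKaehlerEquivOfFormallyEtale k R (Localization.AtPrime m)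
  have : Module.Projective R (Ω[R⁄k]) := inferInstance
  have hf : Module.Free (Localization.AtPrime m) (Localization.AtPrime m ⊗[R] Ω[R⁄k]) := 
    Module.free_of_flat_of_isLocalRing
  refine ⟨Module.Finite.equiv e, Module.Free.of_equiv e, ?_⟩
  rw [← e.finrank_eq, ← Module.rankAtStalk_eq_finrank_tensorProduct ⟨m, inferInstance⟩,
    Module.rankAtStalk_eq]
  exact Ideal.finrank_fiber_eq_finrank (M := Ω[R⁄k]) m

lemma aux_deriv {k A : Type} [Field k] [CommRing A] [Algebra k A]
    (c : A →ₐ[k] k) (m : Ideal A) (hm : RingHom.ker c = m) :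
    ∃ D : Derivation k A m.Cotangent, ∀ x (hx : x ∈ m), D x = m.toCotangent ⟨x, hx⟩ := by
  have hmem : ∀ x, x - algebraMap k A (c x) ∈ m := by
    intro x
    rw [← hm, RingHom.mem_ker]
    simp
  let L : A →ₗ[k] m :=
    { toFun := fun x => ⟨x - algebraMap k A (c x), hmem x⟩
      map_add' := by intro x y; ext; simp; ring
      map_smul' := by intro a x; ext; simp [Algebra.smul_def]; ring }
  refine ⟨Derivation.mk' ((m.toCotangent.restrictScalars k) ∘ₗ L) ?_, ?_⟩
  · intro x y
    simp only [LinearMap.comp_apply, LinearMap.restrictScalars_apply]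
    rw [← map_smul m.toCotangent x, ← map_smul m.toCotangent y, ← map_add, Ideal.toCotangent_eq]
    have : ((L (x * y) : m) : A) - ((x • L y + y • L x : m) : A) = - ((x - algebraMap k A (c x)) * (y - algebraMap k A (c y))) := by
      simp [L]; ring
    rw [this, pow_two]
    exact neg_mem (Ideal.mul_mem_mul (hmem x) (hmem y))
  · intro x hx
    have h0 : c x = 0 := by rw [← hm] at hx; exact hx
    simp [L, h0]

lemma aux_params {k A : Type} [Field k] [CommRing A] [IsLocalRing A] [IsNoetherianRing A] [Algebra k A]
    (c : A →ₐ[k] k) {n : ℕ} [Module.Free A (Ω[A⁄k])] [Module.Finite A (Ω[A⁄k])]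
    (hn : Module.finrank A (Ω[A⁄k]) = n) :
    ∃ u : Fin n → A, Ideal.span (Set.range u) = IsLocalRing.maximalIdeal A := by
  have hker : RingHom.ker c = IsLocalRing.maximalIdeal A := by
    have hs : Function.Surjective c := fun a => ⟨algebraMap k A a, by simp⟩
    have := RingHom.ker_isMaximal_of_surjective c.toRingHom hs
    exact IsLocalRing.eq_maximalIdeal this
  obtain ⟨D, hD⟩ := aux_deriv c _ hker
  let b := Module.finBasisOfFinrankEq A (Ω[A⁄k]) hn
  have hex : ∀ i, ∃ u : IsLocalRing.maximalIdeal A, (IsLocalRing.maximalIdeal A).toCotangent u = D.liftKaehlerDifferential (b i) :=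
    fun i => Ideal.toCotangent_surjective _ _
  choose u hu using hex
  refine ⟨fun i => u i, le_antisymm ?_ ?_⟩
  · rw [Ideal.span_le]; rintro _ ⟨i, rfl⟩; exact (u i).2
  · have hfg : (IsLocalRing.maximalIdeal A).FG := IsNoetherian.noetherian _
    refine Submodule.le_of_le_smul_of_le_jacobson_bot hfg (IsLocalRing.maximalIdeal_le_jacobson ⊥) ?_
    intro x hx
    have h1 : (IsLocalRing.maximalIdeal A).toCotangent ⟨x, hx⟩ ∈ Submodule.span A (Set.range fun i => (IsLocalRing.maximalIdeal A).toCotangent (u i)) := by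
      rw [← hD x hx, ← D.liftKaehlerDifferential_comp_D]
      have : KaehlerDifferential.D k A x ∈ Submodule.span A (Set.range b) := by rw [b.span_eq]; trivial
      have h2 := Submodule.mem_map_of_mem (f := D.liftKaehlerDifferential) this
      rw [Submodule.map_span, ← Set.range_comp] at h2
      convert h2 using 3
      ext i; simp [hu]
    have h3 : (fun i => (IsLocalRing.maximalIdeal A).toCotangent (u i)) = (IsLocalRing.maximalIdeal A).toCotangent ∘ u := rfl
    rw [h3, Set.range_comp, ← Submodule.map_span, Submodule.mem_map] at h1
    obtain ⟨y, hy, hyx⟩ := h1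
    rw [Ideal.toCotangent_eq] at hyx
    have hy' : (y : A) ∈ Ideal.span (Set.range fun i => (u i : A)) := by
      have := Submodule.mem_map_of_mem (f := (IsLocalRing.maximalIdeal A).subtype) hy
      rw [Submodule.map_span, ← Set.range_comp] at this
      exact this
    rw [← sub_sub_cancel (y : A) x]
    refine sub_mem (Submodule.mem_sup_left hy') (Submodule.mem_sup_right ?_)
    rw [smul_eq_mul, ← pow_two]; exact hyx

lemma aux_point {k R : Type} [Field k] [IsAlgClosed k] [CommRing R] [Algebra k R]
    [Algebra.FiniteType k R] (m : Ideal R) [m.IsMaximal] :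
    ∃ c : R →ₐ[k] k, RingHom.ker c = m := by
  letI : Field (R ⧸ m) := Ideal.Quotient.field m
  have : Module.Finite k (R ⧸ m) := finite_of_finite_type_of_isJacobsonRing k (R ⧸ m)
  have hb : Function.Bijective (algebraMap k (R ⧸ m)) := IsAlgClosed.algebraMap_bijective_of_isIntegral
  let e := AlgEquiv.ofBijective (Algebra.ofId k (R ⧸ m)) hb
  refine ⟨e.symm.toAlgHom.comp (Ideal.Quotient.mkₐ k m), ?_⟩
  ext x
  simp [RingHom.mem_ker, Ideal.Quotient.eq_zero_iff_mem]

lemma aux_point_loc {k R : Type} [Field k] [CommRing R] [Algebra k R]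
    (m : Ideal R) [m.IsPrime] (c : R →ₐ[k] k) (hc : RingHom.ker c = m) :
    ∃ c' : Localization.AtPrime m →ₐ[k] k, ∀ x, c' (algebraMap _ _ x) = c x := by
  refine ⟨IsLocalization.liftAlgHom (M := m.primeCompl) (f := c) ?_, ?_⟩
  · rintro ⟨y, hy⟩
    rw [isUnit_iff_ne_zero]
    intro h0
    exact hy (hc ▸ h0)
  · intro x; simp

lemma aux_params' {k R : Type} [Field k] [IsAlgClosed k] [CommRing R] [IsDomain R] [Algebra k R]
    [Algebra.FiniteType k R] [Algebra.FormallySmooth k R] (m : Ideal R) [m.IsMaximal] :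
    ∃ u : Fin (Module.finrank R (Ω[R⁄k])) → R, (∀ i, u i ∈ m) ∧
      Ideal.map (algebraMap R (Localization.AtPrime m)) (Ideal.span (Set.range u)) = IsLocalRing.maximalIdeal (Localization.AtPrime m) := by
  obtain ⟨h1, h2, h3⟩ := aux_rank (k := k) m
  obtain ⟨c, hc⟩ := aux_point (k := k) m
  obtain ⟨c', hc'⟩ := aux_point_loc m c hc
  have : IsNoetherianRing R := Algebra.FiniteType.isNoetherianRing k R
  have : IsNoetherianRing (Localization.AtPrime m) := IsLocalization.isNoetherianRing m.primeCompl _ inferInstance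
  obtain ⟨u, hu⟩ := aux_params c' h3
  have hx : ∀ i, ∃ x : R × m.primeCompl, u i * algebraMap R (Localization.AtPrime m) x.2 = algebraMap R _ x.1 :=
    fun i => IsLocalization.surj m.primeCompl (u i)
  choose x hx using hx
  have hspan : Ideal.map (algebraMap R (Localization.AtPrime m)) (Ideal.span (Set.range fun i => (x i).1)) = IsLocalRing.maximalIdeal (Localization.AtPrime m) := by
    rw [← hu, Ideal.map_span, ← Set.range_comp]
    apply le_antisymm
    · rw [Ideal.span_le]; rintro _ ⟨i, rfl⟩
      simp only [Function.comp, ← hx]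
      exact Ideal.mul_mem_right _ _ (Ideal.subset_span ⟨i, rfl⟩)
    · rw [Ideal.span_le]; rintro _ ⟨i, rfl⟩
      have hun := IsLocalization.map_units (Localization.AtPrime m) (x i).2
      refine (Ideal.mul_unit_mem_iff_mem _ hun).mp ?_
      rw [hx]
      exact Ideal.subset_span ⟨i, rfl⟩
  refine ⟨fun i => (x i).1, fun i => ?_, hspan⟩
  rw [← IsLocalization.AtPrime.to_map_mem_maximal_iff (Localization.AtPrime m) m, ← hspan]
  exact Ideal.mem_map_of_mem _ (Ideal.subset_span ⟨i, rfl⟩)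

lemma aux_dim {k R : Type} [Field k] [IsAlgClosed k] [CommRing R] [IsDomain R] [Algebra k R]
    [Algebra.FiniteType k R] [Algebra.FormallySmooth k R] :
    ringKrullDim R ≤ Module.finrank R (Ω[R⁄k]) := by
  have : IsNoetherianRing R := Algebra.FiniteType.isNoetherianRing k R
  rw [← Ideal.sup_isMaximal_height_eq_ringKrullDim]
  rw [← WithBot.coe_natCast, WithBot.coe_le_coe]
  refine iSup₂_le fun m hm => ?_
  rw [← WithBot.coe_le_coe, ← IsLocalization.AtPrime.ringKrullDim_eq_height m (Localization.AtPrime m)]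
  have : IsNoetherianRing (Localization.AtPrime m) := IsLocalization.isNoetherianRing m.primeCompl _ inferInstance
  refine le_trans (ringKrullDim_le_spanFinrank_maximalIdeal _) ?_
  obtain ⟨u, -, hu⟩ := aux_params' (k := k) m
  rw [← hu, Ideal.map_span]
  have := Submodule.spanFinrank_span_le_ncard_of_finite (R := Localization.AtPrime m) (s := (algebraMap R (Localization.AtPrime m)) '' Set.range u) (Set.toFinite _)
  have h2 := (Set.ncard_image_le (f := algebraMap R (Localization.AtPrime m)) (s := Set.range u) (Set.toFinite _))
  have h3 : (Set.range u).ncard ≤ Module.finrank R (Ω[R⁄k]) := by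
    rw [← Set.image_univ]
    exact (Set.ncard_image_le (Set.toFinite _)).trans (by simp)
  exact_mod_cast this.trans (h2.trans h3)


lemma aux_elem_comp {A B K : Type} [CommRing A] [CommRing B] [CommRing K] (h : A →+* B) (g : B →+* K)
    {x : K} (hx : (g.comp h).IsIntegralElem x) : g.IsIntegralElem x := by
  obtain ⟨p, hp, hpx⟩ := hx
  exact ⟨p.map h, hp.map h, by rw [Polynomial.eval₂_map]; exact hpx⟩

lemma aux_elem_surj {A B K : Type} [CommRing A] [CommRing B] [Nontrivial B] [CommRing K] (h : A →+* B)
    (hs : Function.Surjective h) (g : B →+* K)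
    {x : K} (hx : g.IsIntegralElem x) : (g.comp h).IsIntegralElem x := by
  obtain ⟨p, hp, hpx⟩ := hx
  obtain ⟨q, hq, hqm⟩ := Polynomial.lifts_and_degree_eq_and_monic (f := h) (p := p)
    (by rw [Polynomial.lifts_iff_coeff_lifts]; intro n; exact hs _) hp
  refine ⟨q, hqm.2, ?_⟩
  rw [← Polynomial.eval₂_map, hq]; exact hpx

lemma aux_adjoin_iff {k K : Type} [Field k] [CommRing K] [Nontrivial K] [Algebra k K] {r : ℕ} (σ : Fin r → K) (x : K) :
    IsIntegral (Algebra.adjoin k (Set.range σ)) x ↔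
      (MvPolynomial.aeval (R := k) σ).toRingHom.IsIntegralElem x := by
  have hmem : ∀ p : MvPolynomial (Fin r) k, MvPolynomial.aeval σ p ∈ Algebra.adjoin k (Set.range σ) := by
    intro p
    rw [Algebra.adjoin_range_eq_range_aeval]; exact ⟨p, rfl⟩
  let h : MvPolynomial (Fin r) k →+* Algebra.adjoin k (Set.range σ) :=
    ((MvPolynomial.aeval σ).codRestrict _ hmem).toRingHom
  have hs : Function.Surjective h := by
    rintro ⟨y, hy⟩
    have hy' := hy
    rw [Algebra.adjoin_range_eq_range_aeval] at hy'
    obtain ⟨p, hp⟩ := hy'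
    exact ⟨p, Subtype.ext hp⟩
  have hc : (algebraMap (Algebra.adjoin k (Set.range σ)) K).comp h = (MvPolynomial.aeval (R := k) σ).toRingHom := by
    ext <;> rfl
  rw [← hc]
  exact ⟨fun hx => aux_elem_surj h hs _ hx, fun hx => aux_elem_comp h _ hx⟩

lemma aux_elem_inj {k D K : Type} [Field k] [CommRing D] [CommRing K] [Algebra k K] [Algebra k D] [Algebra D K]
    [IsScalarTower k D K] (hi : Function.Injective (algebraMap D K))
    {r : ℕ} (σ : Fin r → D) (x : D) :
    (MvPolynomial.aeval (R := k) σ).toRingHom.IsIntegralElem x ↔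
    (MvPolynomial.aeval (R := k) (fun i => algebraMap D K (σ i))).toRingHom.IsIntegralElem (algebraMap D K x) := by
  have hc : (algebraMap D K).comp (MvPolynomial.aeval (R := k) σ).toRingHom = (MvPolynomial.aeval (R := k) (fun i => algebraMap D K (σ i))).toRingHom := by
    ext 
    · simp [← IsScalarTower.algebraMap_apply]
    · simp
  unfold RingHom.IsIntegralElem
  rw [← hc]
  refine exists_congr fun p => and_congr_right fun _ => ?_
  rw [← Polynomial.hom_eval₂]
  exact (map_eq_zero_iff _ hi).symm

lemma aux_trans {k K : Type} [Field k] [Field K] [Algebra k K] {r : ℕ} (σ' : Fin r → K)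
    (T : Subalgebra k K) (hT : ∀ i, IsIntegral T (σ' i)) (x : K)
    (hx : IsIntegral (Algebra.adjoin k (Set.range σ')) x) : IsIntegral T x := by
  let E := integralClosure T K
  have hE : ∀ y ∈ Algebra.adjoin k (Set.range σ'), y ∈ E := by
    have : Algebra.adjoin k (Set.range σ') ≤ E.restrictScalars k := by
      rw [Algebra.adjoin_le_iff]
      rintro _ ⟨i, rfl⟩
      exact hT i
    exact this
  let g : Algebra.adjoin k (Set.range σ') →+* E :=
    { toFun := fun y => ⟨y, hE y y.2⟩
      map_one' := rfl
      map_mul' := fun _ _ => rfl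
      map_zero' := rfl
      map_add' := fun _ _ => rfl }
  have h1 : IsIntegral E x := by
    obtain ⟨p, hp, hpx⟩ := hx
    exact ⟨p.map g, hp.map g, by rw [Polynomial.eval₂_map]; exact hpx⟩
  exact isIntegral_trans (A := E) _ h1

lemma aux_intD {k D : Type} [Field k] [CommRing D] [IsDomain D] [Algebra k D] {r : ℕ}
    (σ u : Fin r → D) (h : (MvPolynomial.aeval (R := k) σ).toRingHom.IsIntegral) :
    ∃ M, 2 ≤ M ∧ (MvPolynomial.aeval (R := k) (fun i => u i + σ i ^ M)).toRingHom.IsIntegral := by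
  have hi : Function.Injective (algebraMap D (FractionRing D)) := IsFractionRing.injective _ _
  set σ' : Fin r → FractionRing D := fun i => algebraMap D _ (σ i) with hσ'
  have h' : ∀ x : D, IsIntegral (Algebra.adjoin k (Set.range σ')) (algebraMap D (FractionRing D) x) := by
    intro x
    rw [aux_adjoin_iff]
    exact (aux_elem_inj hi σ x).mp (h x)
  obtain ⟨M, hM, hM2⟩ := aux_integral σ' (fun i => algebraMap D _ (u i)) (fun i => h' (u i))
  refine ⟨M, hM, fun x => ?_⟩
  rw [aux_elem_inj (K := FractionRing D) hi, ← aux_adjoin_iff]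
  have hfun : (fun i => algebraMap D (FractionRing D) (u i + σ i ^ M)) = fun i => algebraMap D (FractionRing D) (u i) + algebraMap D (FractionRing D) (σ i) ^ M := by
    ext i; rw [map_add, map_pow]
  rw [hfun]
  change ∀ i, IsIntegral (Algebra.adjoin k (Set.range fun i => algebraMap D (FractionRing D) (u i) + algebraMap D (FractionRing D) (σ i) ^ M)) (σ' i) at hM2
  generalize Algebra.adjoin k (Set.range fun i => algebraMap D (FractionRing D) (u i) + algebraMap D (FractionRing D) (σ i) ^ M) = T at *
  exact aux_trans σ' T hM2 _ (h' x)

lemma aux_shift {k D : Type} [Field k] [CommRing D] [Algebra k D] {r : ℕ}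
    (s : Fin r → D) (c : Fin r → k) (h : (MvPolynomial.aeval (R := k) s).toRingHom.IsIntegral) :
    (MvPolynomial.aeval (R := k) (fun i => s i - algebraMap k D (c i))).toRingHom.IsIntegral := by
  intro x
  refine aux_elem_comp (MvPolynomial.aeval (R := k) (fun i => (MvPolynomial.X i + MvPolynomial.C (c i) : MvPolynomial (Fin r) k))).toRingHom _ ?_
  convert! h x
  ext
  · simp
  · simp

open scoped TensorProduct

lemma aux_finmax {k R : Type} [Field k] [CommRing R] [Algebra k R] [Algebra.FiniteType k R]
    (p : Ideal R) {r : ℕ} (τ : Fin r → R)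
    (h : (MvPolynomial.aeval (R := k) (fun i => Ideal.Quotient.mk p (τ i))).toRingHom.IsIntegral) :
    {M : Ideal R | M.IsMaximal ∧ p ≤ M ∧ ∀ i, τ i ∈ M}.Finite := by
  set J : Ideal R := p ⊔ Ideal.span (Set.range τ) with hJ
  have hpJ : p ≤ J := le_sup_left
  have hτJ : ∀ i, τ i ∈ J := fun i => Submodule.mem_sup_right (Ideal.subset_span ⟨i, rfl⟩)
  have : Algebra.IsIntegral k (R ⧸ J) := by
    constructor
    intro x
    obtain ⟨x, rfl⟩ := Ideal.Quotient.mk_surjective x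
    obtain ⟨P, hP, hPx⟩ := h (Ideal.Quotient.mk p x)
    refine ⟨P.map (MvPolynomial.aeval (R := k) (fun _ => (0 : k))).toRingHom, hP.map _, ?_⟩
    have hPx' := congrArg (Ideal.Quotient.factor hpJ) hPx
    rw [Polynomial.hom_eval₂, map_zero] at hPx'
    rw [Polynomial.eval₂_map]
    rw [Ideal.Quotient.factor_mk] at hPx'
    convert! hPx' using 2
    ext a
    · simp
      rfl
    · simp only [AlgHom.toRingHom_eq_coe, RingHom.coe_comp, RingHom.coe_coe, Function.comp_apply, MvPolynomial.aeval_X, map_zero, Ideal.Quotient.factor_mk]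
      exact (Ideal.Quotient.eq_zero_iff_mem.mpr (hτJ a)).symm
  have : Module.Finite k (R ⧸ J) := Algebra.IsIntegral.finite
  have : IsArtinianRing (R ⧸ J) := IsArtinianRing.of_finite k _
  have hfin : {I : Ideal (R ⧸ J) | I.IsMaximal}.Finite := IsArtinianRing.setOfPred_isMaximal_finite (R ⧸ J)
  refine (hfin.image (fun I => I.comap (Ideal.Quotient.mk J))).subset ?_
  rintro M ⟨hM, hpM, hτM⟩
  have hJM : J ≤ M := by
    rw [hJ, sup_le_iff, Ideal.span_le]
    exact ⟨hpM, by rintro _ ⟨i, rfl⟩; exact hτM i⟩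
  refine ⟨M.map (Ideal.Quotient.mk J), ?_, ?_⟩
  · rcases Ideal.map_eq_top_or_isMaximal_of_surjective (Ideal.Quotient.mk J) Ideal.Quotient.mk_surjective hM with h | h
    · exfalso
      have h2 := congrArg (Ideal.comap (Ideal.Quotient.mk J)) h
      rw [Ideal.comap_map_of_surjective _ Ideal.Quotient.mk_surjective] at h2
      rw [← RingHom.ker_eq_comap_bot, Ideal.mk_ker, sup_eq_left.mpr hJM] at h2
      exact hM.ne_top (by simpa using h2)
    · exact h
  · change Ideal.comap _ _ = M
    rw [Ideal.comap_map_of_surjective _ Ideal.Quotient.mk_surjective, ← RingHom.ker_eq_comap_bot, Ideal.mk_ker, sup_eq_left.mpr hJM]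

lemma aux_nak {R A : Type} [CommRing R] [CommRing A] [IsLocalRing A] [IsNoetherianRing A] [Algebra R A]
    (m : Ideal R) (hm : m.map (algebraMap R A) = IsLocalRing.maximalIdeal A) {n : ℕ} (u t : Fin n → R)
    (hu : Ideal.map (algebraMap R A) (Ideal.span (Set.range u)) = IsLocalRing.maximalIdeal A)
    (htm : ∀ i, t i ∈ m) (htu : ∀ i, u i - t i ∈ m ^ 2) :
    Ideal.map (algebraMap R A) (Ideal.span (Set.range t)) = IsLocalRing.maximalIdeal A := by
  apply le_antisymm
  · rw [← hm]
    exact Ideal.map_mono (by rw [Ideal.span_le]; rintro _ ⟨i, rfl⟩; exact htm i)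
  · have hfg : (IsLocalRing.maximalIdeal A).FG := IsNoetherian.noetherian _
    refine Submodule.le_of_le_smul_of_le_jacobson_bot hfg (IsLocalRing.maximalIdeal_le_jacobson ⊥) ?_
    nth_rw 1 [← hu]
    rw [Ideal.map_le_iff_le_comap, Ideal.span_le]
    rintro _ ⟨i, rfl⟩
    rw [SetLike.mem_coe, Ideal.mem_comap]
    have : u i = t i + (u i - t i) := by ring
    rw [this, map_add]
    refine Submodule.add_mem_sup (Ideal.mem_map_of_mem _ (Ideal.subset_span ⟨i, rfl⟩)) ?_
    rw [smul_eq_mul, ← pow_two, ← hm, ← Ideal.map_pow]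
    exact Ideal.mem_map_of_mem _ (htu i)

lemma aux_t {k R : Type} [Field k] [IsAlgClosed k] [CommRing R] [Algebra k R]
    [Algebra.FiniteType k R] (m p : Ideal R) [m.IsMaximal] [p.IsPrime] {n r : ℕ} (hrn : r < n)
    (s : Fin r → R ⧸ p) (hs : (MvPolynomial.aeval (R := k) s).toRingHom.IsIntegral)
    (u : Fin n → R) (hum : ∀ i, u i ∈ m) :
    ∃ t : Fin n → R, (∀ i, t i ∈ m) ∧ (∀ i, u i - t i ∈ m ^ 2) ∧
      (MvPolynomial.aeval (R := k) (fun i => Ideal.Quotient.mk p (t i))).toRingHom.IsIntegral ∧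
      ∀ M : Ideal R, M.IsMaximal → p ≤ M → (∀ i, t i ∈ M) → M = m := by
  classical
  obtain ⟨c, hc⟩ := aux_point (k := k) m
  choose s' hs' using fun i => Ideal.Quotient.mk_surjective (s i)
  let σ : Fin r → R := fun i => s' i - algebraMap k R (c (s' i))
  have hσm : ∀ i, σ i ∈ m := by
    intro i
    rw [← hc, RingHom.mem_ker]
    simp [σ]
  have hσ := aux_shift s (fun i => c (s' i)) hs
  let j : Fin r → Fin n := Fin.castLE hrn.le
  obtain ⟨M, hM2, hM⟩ := aux_intD _ (fun i => Ideal.Quotient.mk p (u (j i))) hσ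
  let τ : Fin r → R := fun i => u (j i) + σ i ^ M
  have hτ : (MvPolynomial.aeval (R := k) (fun i => Ideal.Quotient.mk p (τ i))).toRingHom.IsIntegral := by
    convert! hM using 4 with i
    simp only [τ, σ, map_add, map_pow, map_sub, hs']
    rfl
  have hfin := aux_finmax p τ hτ
  let F := hfin.toFinset.erase m
  have hF : ∀ N ∈ F, N.IsMaximal ∧ N ≠ m := by
    intro N hN
    simp only [F, Finset.mem_erase, Set.Finite.mem_toFinset] at hN
    exact ⟨hN.2.1, hN.1⟩
  have hcop : IsCoprime (m ^ 2) (∏ N ∈ F, N) := by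
    refine IsCoprime.pow_left (IsCoprime.prod_right fun N hN => ?_)
    have := (hF N hN).1
    exact Ideal.isCoprime_of_isMaximal (hF N hN).2.symm
  obtain ⟨a, ha, b, hb, hab⟩ := Ideal.isCoprime_iff_exists.mp hcop
  let ℓ : Fin n := ⟨n - 1, by omega⟩
  let t : Fin n → R := fun i => if h : (i : ℕ) < r then τ ⟨i, h⟩ else if i = ℓ then u i + a * (1 - u i) else u i
  have htu : ∀ i, u i - t i ∈ m ^ 2 := by
    intro i
    simp only [t]
    split_ifs with h1 h2
    · have : u i - τ ⟨i, h1⟩ = - (σ ⟨i, h1⟩ ^ M) := by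
        simp only [τ, j]
        have : (Fin.castLE hrn.le ⟨i, h1⟩ : Fin n) = i := by ext; simp
        rw [this]; ring
      rw [this]
      exact neg_mem (Ideal.pow_le_pow_right hM2 (Ideal.pow_mem_pow (hσm _) M))
    · have : u i - (u i + a * (1 - u i)) = a * (u i - 1) := by ring
      rw [this]
      exact Ideal.mul_mem_right _ _ ha
    · simp
  have htj : ∀ i, t (j i) = τ i := by
    intro i
    simp [t, j]
  have htl : t ℓ = u ℓ + a * (1 - u ℓ) := by
    have : ¬ (n - 1 < r) := by omega
    simp [t, ℓ, this]
  refine ⟨t, fun i => ?_, htu, ?_, ?_⟩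
  · have h1 := Ideal.pow_le_self two_ne_zero (htu i)
    have : t i = u i - (u i - t i) := by ring
    rw [this]
    exact sub_mem (hum i) h1
  · intro x
    refine aux_elem_comp (MvPolynomial.rename (R := k) j).toRingHom _ ?_
    convert! hτ x
    ext a
    · simp
    · simp [htj]
  · intro N hN hpN htN
    by_contra hne
    have hNF : N ∈ F := by
      simp only [F, Finset.mem_erase, Set.Finite.mem_toFinset]
      exact ⟨hne, hN, hpN, fun i => htj i ▸ htN _⟩
    have hbN : b ∈ N := by
      have : ∏ N ∈ F, N ≤ N := Ideal.prod_le_inf.trans (Finset.inf_le hNF)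
      exact this hb
    have h1 := htN ℓ
    rw [htl] at h1
    apply hN.ne_top
    rw [Ideal.eq_top_iff_one]
    have : (1 : R) = (u ℓ + a * (1 - u ℓ)) + b * (1 - u ℓ) := by
      linear_combination (u ℓ - 1) * hab
    rw [this]
    exact add_mem h1 (Ideal.mul_mem_right _ _ hbN)

open scoped TensorProduct

lemma aux_m_eq {R : Type} [CommRing R] (m p : Ideal R) [m.IsMaximal] {n : ℕ} (t : Fin n → R)
    (ht : Ideal.map (algebraMap R (Localization.AtPrime m)) (Ideal.span (Set.range t)) =
      IsLocalRing.maximalIdeal (Localization.AtPrime m))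
    (hM : ∀ M : Ideal R, M.IsMaximal → p ≤ M → (∀ i, t i ∈ M) → M = m) :
    m ≤ p ⊔ Ideal.span (Set.range t) := by
  intro x hx
  set I := p ⊔ Ideal.span (Set.range t) with hI
  let J : Ideal R := I.colon {x}
  have hJ : J = ⊤ := by
    by_contra hne
    obtain ⟨M, hMm, hJM⟩ := Ideal.exists_le_maximal J hne
    have hIM : I ≤ M := by
      refine le_trans ?_ hJM
      intro y hy
      rw [Submodule.mem_colon_singleton]
      exact Ideal.mul_mem_right _ _ hy
    have hMeq : M = m := hM M hMm (le_sup_left.trans hIM)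
      (fun i => hIM (Submodule.mem_sup_right (Ideal.subset_span ⟨i, rfl⟩)))
    subst hMeq
    have h1 : algebraMap R (Localization.AtPrime M) x ∈ Ideal.map (algebraMap R (Localization.AtPrime M)) (Ideal.span (Set.range t)) := by
      rw [ht]
      exact (IsLocalization.AtPrime.to_map_mem_maximal_iff (Localization.AtPrime M) M x).mpr hx
    rw [IsLocalization.algebraMap_mem_map_algebraMap_iff M.primeCompl] at h1
    obtain ⟨s, hs, hsx⟩ := h1
    apply hs
    apply hJM
    rw [Submodule.mem_colon_singleton]
    exact Submodule.mem_sup_right hsx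
  have : (1 : R) ∈ J := by rw [hJ]; trivial
  rw [Submodule.mem_colon_singleton, one_smul] at this
  exact this

lemma aux_surjB {B R : Type} [CommRing B] [CommRing R] [Algebra B R] (p : Ideal R) (q : Ideal B)
    [Module.Finite B (R ⧸ p)]
    (h : ∀ x : R, ∃ y : B, x - algebraMap B R y ∈ p ⊔ q.map (algebraMap B R)) :
    ∃ b : B, b - 1 ∈ q ∧ ∀ x : R, ∃ y : B, algebraMap B R b * x - algebraMap B R y ∈ p := by
  let L : Submodule B (R ⧸ p) := LinearMap.range (Algebra.linearMap B (R ⧸ p))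
  have key : (⊤ : Submodule B ((R ⧸ p) ⧸ L)) ≤ q • ⊤ := by
    rintro x -
    obtain ⟨x, rfl⟩ := L.mkQ_surjective x
    obtain ⟨x, rfl⟩ := Ideal.Quotient.mk_surjective x
    obtain ⟨y, hy⟩ := h x
    obtain ⟨a, ha, c, hc, hac⟩ := Submodule.mem_sup.mp hy
    have hx : L.mkQ (Ideal.Quotient.mk p x) = L.mkQ (Ideal.Quotient.mk p c) := by
      rw [Submodule.mkQ_apply, Submodule.mkQ_apply, Submodule.Quotient.eq]
      refine ⟨y, ?_⟩
      have : x - c = algebraMap B R y + a := by linear_combination -hac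
      rw [← map_sub, this, map_add, Ideal.Quotient.eq_zero_iff_mem.mpr ha, add_zero]
      rfl
    rw [hx]
    refine Submodule.span_induction (p := fun c _ => L.mkQ (Ideal.Quotient.mk p c) ∈ q • (⊤ : Submodule B ((R ⧸ p) ⧸ L))) ?_ ?_ ?_ ?_ (show c ∈ Ideal.span _ from hc)
    · rintro _ ⟨z, hz, rfl⟩
      have : L.mkQ (Ideal.Quotient.mk p (algebraMap B R z)) = 0 := by
        rw [Submodule.mkQ_apply, Submodule.Quotient.mk_eq_zero]
        exact ⟨z, rfl⟩
      rw [this]; exact zero_mem _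
    · simp
    · intro x y _ _ hx hy
      rw [map_add, map_add]; exact add_mem hx hy
    · intro r x hx _
      have hxx : x ∈ q.map (algebraMap B R) := hx
      have h3 : (Ideal.Quotient.mk p (r • x)) ∈ q • (⊤ : Submodule B (R ⧸ p)) := by
        refine Submodule.span_induction (p := fun x _ => (Ideal.Quotient.mk p (r • x)) ∈ q • (⊤ : Submodule B (R ⧸ p))) ?_ ?_ ?_ ?_ (show x ∈ Ideal.span _ from hx)
        · rintro _ ⟨z, hz, rfl⟩
          have : Ideal.Quotient.mk p (r • algebraMap B R z) = z • Ideal.Quotient.mk p r := by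
            rw [smul_eq_mul, map_mul, mul_comm, Algebra.smul_def]; rfl
          rw [this]
          exact Submodule.smul_mem_smul hz trivial
        · simp
        · intro x y _ _ hx hy
          rw [smul_add, map_add]; exact add_mem hx hy
        · intro a x _ hx
          have : Ideal.Quotient.mk p (r • a • x) = Ideal.Quotient.mk p a * Ideal.Quotient.mk p (r • x) := by
            rw [← map_mul]; congr 1; simp only [smul_eq_mul]; ring
          rw [this]
          have h4 := Submodule.mem_map_of_mem (f := LinearMap.mulLeft B (Ideal.Quotient.mk p a)) hx
          rw [Submodule.map_smul''] at h4
          exact Submodule.smul_mono le_rfl le_top h4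
      have h4 := Submodule.mem_map_of_mem (f := L.mkQ) h3
      rw [Submodule.map_smul''] at h4
      exact Submodule.smul_mono le_rfl le_top h4
  obtain ⟨b, hb, hb2⟩ := Submodule.exists_sub_one_mem_and_smul_eq_zero_of_fg_of_le_smul q
    (⊤ : Submodule B ((R ⧸ p) ⧸ L)) Module.Finite.fg_top key
  refine ⟨b, hb, fun x => ?_⟩
  have h5 := hb2 (L.mkQ (Ideal.Quotient.mk p x)) trivial
  rw [← map_smul, Submodule.mkQ_apply, Submodule.Quotient.mk_eq_zero] at h5
  obtain ⟨y, hy⟩ := h5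
  refine ⟨y, ?_⟩
  rw [← Ideal.Quotient.eq_zero_iff_mem, map_sub, map_mul, sub_eq_zero]
  rw [Algebra.smul_def] at hy
  exact hy.symm

open scoped TensorProduct

lemma aux_ht_one {R : Type} [CommRing R] [IsDomain R] (p Q : Ideal R) [p.IsPrime] [Q.IsPrime]
    (hp : p.height = 1) (h : Q < p) : Q = ⊥ := by
  have h1 := Ideal.height_add_one_le_of_lt_of_isPrime h
  rw [hp] at h1
  have h0 : Q.height = 0 := by
    have : Q.height + 1 ≤ 0 + 1 := by simpa using h1
    have := (ENat.add_le_add_iff_right ENat.one_ne_top).mp this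
    simpa using this
  rw [Ideal.height_eq_zero_iff, IsDomain.minimalPrimes_eq_singleton_bot] at h0
  exact h0

lemma aux_main_B {B R : Type} [CommRing B] [IsDomain B] [UniqueFactorizationMonoid B]
    [CommRing R] [IsDomain R] [IsNoetherianRing R] [Algebra B R]
    (m p : Ideal R) [m.IsMaximal] [p.IsPrime] (hpm : p ≤ m) (hp : p.height = 1)
    [Algebra.FormallyUnramified B (Localization.AtPrime m)] [Module.Flat B (Localization.AtPrime m)]
    (hb : ∃ b : B, algebraMap B R b ∉ m ∧ ∀ x : R, ∃ y : B, algebraMap B R b * x - algebraMap B R y ∈ p)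
    (hP : p.comap (algebraMap B R) ≠ ⊥) :
    ∃ g, p.map (algebraMap R (Localization.AtPrime m)) = Ideal.span {g} := by
  set A := Localization.AtPrime m with hA
  have hNA : IsNoetherianRing A := IsLocalization.isNoetherianRing m.primeCompl _ inferInstance
  have hdis : Disjoint (m.primeCompl : Set R) (p : Set R) := by
    rw [Set.disjoint_left]; intro x hx hxp; exact hx (hpm hxp)
  have hpA : (p.map (algebraMap R A)).IsPrime :=
    IsLocalization.isPrime_of_isPrime_disjoint m.primeCompl A p inferInstance hdis
  have hcomap : (p.map (algebraMap R A)).comap (algebraMap R A) = p :=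
    IsLocalization.under_map_of_isPrime_disjoint m.primeCompl A inferInstance hdis
  have hBA : ∀ b, algebraMap B A b = algebraMap R A (algebraMap B R b) := fun b => IsScalarTower.algebraMap_apply B R A b
  have hRA : Function.Injective (algebraMap R A) := IsLocalization.injective A m.primeCompl_le_nonZeroDivisors
  have hinjB : ∀ b, algebraMap B R b = 0 → b = 0 := by
    intro b hb0
    have h1 : b • (1 : A) = 0 := by rw [Algebra.smul_def, hBA, hb0]; simp
    exact (smul_eq_zero.mp h1).resolve_right one_ne_zero
  -- the prime downstairs is principal
  set P : Ideal B := p.comap (algebraMap B R) with hPdef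
  have hPprime : P.IsPrime := Ideal.IsPrime.comap _
  obtain ⟨f, hfP, hf⟩ := hPprime.exists_mem_prime_of_ne_bot hP
  have hPf : P = Ideal.span {f} := by
    by_contra hne
    have hle : Ideal.span {f} ≤ P := by rwa [Ideal.span_singleton_le_iff_mem]
    have hlt : Ideal.span {f} < P := lt_of_le_of_ne hle (Ne.symm hne)
    have hfpr : (Ideal.span {f}).IsPrime := (Ideal.span_singleton_prime hf.ne_zero).mpr hf
    have hlies : (p.map (algebraMap R A)).LiesOver P := by
      constructor
      ext b
      change algebraMap B R b ∈ p ↔ algebraMap B A b ∈ p.map (algebraMap R A)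
      rw [hBA, ← Ideal.mem_comap (f := algebraMap R A), hcomap]
    obtain ⟨Q, hQlt, hQ, hQf⟩ := Ideal.exists_ideal_lt_liesOver_of_lt (p := Ideal.span {f}) (q := P) (p.map (algebraMap R A)) hlt
    have hQR : Q.comap (algebraMap R A) < p := by
      refine lt_of_le_of_ne ?_ ?_
      · rw [← hcomap]; exact Ideal.comap_mono hQlt.le
      · intro heq
        apply hQlt.not_ge
        rw [← heq]
        exact Ideal.map_comap_le
    have hbot : Q.comap (algebraMap R A) = ⊥ := by
      have hpr : (Q.comap (algebraMap R A)).IsPrime := Ideal.IsPrime.comap _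
      exact aux_ht_one p _ hp hQR
    have hfQ : algebraMap B A f ∈ Q := by
      have : f ∈ Q.under B := by
        rw [← hQf.over]; exact Ideal.mem_span_singleton_self f
      exact this
    rw [hBA, ← Ideal.mem_comap, hbot] at hfQ
    exact hf.ne_zero (hinjB f hfQ)
  -- localise the base
  set q : Ideal B := m.comap (algebraMap B R) with hq
  let φ : Localization.AtPrime q →+* A := Localization.localRingHom q m (algebraMap B R) rfl
  let : Algebra (Localization.AtPrime q) A := φ.toAlgebra
  have htow : IsScalarTower B (Localization.AtPrime q) A := by
    refine IsScalarTower.of_algebraMap_eq fun b => ?_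
    rw [hBA]
    exact (Localization.localRingHom_to_map q m (algebraMap B R) rfl b).symm
  have hunr : Algebra.FormallyUnramified (Localization.AtPrime q) A :=
    Algebra.FormallyUnramified.of_restrictScalars B _ _
  obtain ⟨b, hbm, hby⟩ := hb
  have hmk : ∀ (y : B) (s : q.primeCompl), algebraMap B A s * algebraMap (Localization.AtPrime q) A (IsLocalization.mk' _ y s) = algebraMap B A y := by
    intro y s
    rw [IsScalarTower.algebraMap_apply B (Localization.AtPrime q) A, ← map_mul, IsLocalization.mk'_spec', ← IsScalarTower.algebraMap_apply]
  have hnotmem : ∀ s : R, s ∉ m → algebraMap R A s ∉ p.map (algebraMap R A) := by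
    intro s hs hmem
    rw [← Ideal.mem_comap, hcomap] at hmem
    exact hs (hpm hmem)
  refine ⟨_, aux_local (C := Localization.AtPrime q) (p.map (algebraMap R A)) hpA.ne_top ?_ (algebraMap B _ f) ?_⟩
  · intro x
    obtain ⟨x, rfl⟩ := Ideal.Quotient.mk_surjective x
    obtain ⟨⟨r, s⟩, hrs⟩ := IsLocalization.surj m.primeCompl x
    simp only at hrs
    obtain ⟨y, hy⟩ := hby r
    obtain ⟨z, hz⟩ := hby s
    have hzq : z ∉ q := by
      intro hzq
      have h1 : algebraMap B R b * s ∈ m := by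
        have := add_mem (hpm hz) (show algebraMap B R z ∈ m from hzq)
        simpa using this
      rcases (inferInstance : m.IsPrime).mem_or_mem h1 with h | h
      · exact hbm h
      · exact s.2 h
    refine ⟨IsLocalization.mk' (M := q.primeCompl) _ y ⟨z, hzq⟩, ?_⟩
    change Ideal.Quotient.mk _ (algebraMap (Localization.AtPrime q) A _) = _
    rw [Ideal.Quotient.eq]
    set w := algebraMap (Localization.AtPrime q) A (IsLocalization.mk' (M := q.primeCompl) _ y ⟨z, hzq⟩) with hw
    have hw1 := hmk y ⟨z, hzq⟩
    rw [← hw] at hw1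
    -- multiply by z
    have h2 : algebraMap R A (algebraMap B R z) * (w - x) ∈ p.map (algebraMap R A) := by
      have h3 : algebraMap R A s * (algebraMap R A (algebraMap B R z) * (w - x)) ∈ p.map (algebraMap R A) := by
        have hy' := Ideal.mem_map_of_mem (algebraMap R A) hy
        have hz' := Ideal.mem_map_of_mem (algebraMap R A) hz
        rw [map_sub, map_mul] at hy' hz'
        rw [hBA, hBA] at hw1
        have : algebraMap R A s * (algebraMap R A (algebraMap B R z) * (w - x)) =
          - algebraMap R A s * (algebraMap R A (algebraMap B R b) * algebraMap R A r - algebraMap R A (algebraMap B R y))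
           + algebraMap R A r * (algebraMap R A (algebraMap B R b) * algebraMap R A s - algebraMap R A (algebraMap B R z)) := by
          linear_combination algebraMap R A s * hw1 - algebraMap R A (algebraMap B R z) * hrs
        rw [this]
        exact add_mem (Ideal.mul_mem_left _ _ hy') (Ideal.mul_mem_left _ _ hz')
      exact (hpA.mem_or_mem h3).resolve_left (hnotmem _ s.2)
    exact (hpA.mem_or_mem h2).resolve_left (hnotmem _ hzq)
  · ext x
    obtain ⟨⟨y, s⟩, rfl⟩ := IsLocalization.mk'_surjective q.primeCompl x
    have h1 : IsLocalization.mk' (Localization.AtPrime q) y s ∈ RingHom.ker (algebraMap (Localization.AtPrime q) (A ⧸ p.map (algebraMap R A))) ↔ y ∈ P := by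
      rw [RingHom.mem_ker]
      change Ideal.Quotient.mk _ (algebraMap (Localization.AtPrime q) A _) = _ ↔ _
      rw [Ideal.Quotient.eq_zero_iff_mem]
      have h2 := hmk y s
      rw [hBA, hBA] at h2
      have h3 : y ∈ P ↔ algebraMap R A (algebraMap B R y) ∈ p.map (algebraMap R A) := by
        rw [← Ideal.mem_comap, hcomap]; rfl
      rw [h3, ← h2]
      constructor
      · intro h; exact Ideal.mul_mem_left _ _ h
      · intro h; exact (hpA.mem_or_mem h).resolve_left (hnotmem _ s.2)
    rw [h1, IsLocalization.mk'_mem_iff]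
    rw [← Set.image_singleton, ← Ideal.map_span, ← hPf,
      IsLocalization.algebraMap_mem_map_algebraMap_iff q.primeCompl]
    constructor
    · intro h
      exact ⟨1, one_mem _, by simpa using h⟩
    · rintro ⟨c, hc, hcy⟩
      exact (hPprime.mem_or_mem hcy).resolve_left fun h => hc (hpm h)

open scoped TensorProduct

lemma aux_dim_quot {R : Type} [CommRing R] [IsDomain R] (p : Ideal R) (hp : p ≠ ⊥) :
    ringKrullDim (R ⧸ p) + 1 ≤ ringKrullDim R := by
  obtain ⟨x, hx, hx0⟩ := Submodule.exists_mem_ne_zero_of_ne_bot hp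
  have h1 := ringKrullDim_quotient_succ_le_of_nonZeroDivisor (mem_nonZeroDivisors_of_ne_zero hx0)
  refine le_trans ?_ h1
  have hle : Ideal.span {x} ≤ p := by rwa [Ideal.span_singleton_le_iff_mem]
  have := ringKrullDim_le_of_surjective (Ideal.Quotient.factor hle) (Ideal.Quotient.factor_surjective hle)
  gcongr

lemma aux_main {k R : Type} [Field k] [IsAlgClosed k] [CommRing R] [IsDomain R] [Algebra k R]
    [Algebra.FiniteType k R] [Algebra.FormallySmooth k R]
    (m p : Ideal R) [m.IsMaximal] [p.IsPrime] (hpm : p ≤ m) (hp : p.height = 1) :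
    ∃ g, p.map (algebraMap R (Localization.AtPrime m)) = Ideal.span {g} := by
  have hNR : IsNoetherianRing R := Algebra.FiniteType.isNoetherianRing k R
  have hNA : IsNoetherianRing (Localization.AtPrime m) := IsLocalization.isNoetherianRing m.primeCompl _ inferInstance
  obtain ⟨hΩ1, hΩ2, hΩ3⟩ := aux_rank (k := k) m
  obtain ⟨u, hum, hu⟩ := aux_params' (k := k) m
  have hdim := aux_dim (k := k) (R := R)
  generalize Module.finrank R (Ω[R⁄k]) = n at *
  have hp0 : p ≠ ⊥ := by
    rintro rfl
    simp at hp
  have hdimp : ringKrullDim (R ⧸ p) + 1 ≤ n := (aux_dim_quot p hp0).trans hdim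
  obtain ⟨r, g, hgi, hgint⟩ := exists_integral_inj_algHom_of_fg k (R ⧸ p)
  have hdimpoly : ∀ d : ℕ, ringKrullDim (MvPolynomial (Fin d) k) = d := by
    intro d
    rw [MvPolynomial.ringKrullDim_of_isNoetherianRing]
    simp
  have hr : r < n := by
    let : Algebra (MvPolynomial (Fin r) k) (R ⧸ p) := g.toRingHom.toAlgebra
    have : Algebra.IsIntegral (MvPolynomial (Fin r) k) (R ⧸ p) := ⟨hgint⟩
    have h1 := aux_dim_le (A := MvPolynomial (Fin r) k) (D := R ⧸ p) hgi
    rw [hdimpoly] at h1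
    have h2 : ((r + 1 : ℕ) : WithBot ℕ∞) ≤ (n : ℕ) := by
      refine le_trans ?_ hdimp
      push_cast
      gcongr
    exact_mod_cast h2
  have hg : g = MvPolynomial.aeval (fun i => g (MvPolynomial.X i)) := by
    ext i; simp
  obtain ⟨t, htm, htu, htint, hMax⟩ := aux_t (k := k) m p hr (fun i => g (MvPolynomial.X i)) (by rw [← hg]; exact hgint) u hum
  have hmA : m.map (algebraMap R (Localization.AtPrime m)) = IsLocalRing.maximalIdeal (Localization.AtPrime m) :=
    Localization.AtPrime.map_eq_maximalIdeal
  have htA := aux_nak m hmA u t hu htm htu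
  have hm := aux_m_eq m p t htA hMax
  let : Algebra (MvPolynomial (Fin n) k) R := (MvPolynomial.aeval (R := k) t).toRingHom.toAlgebra
  have hX : ∀ i, algebraMap (MvPolynomial (Fin n) k) R (MvPolynomial.X i) = t i := fun i => MvPolynomial.aeval_X t i
  have htow : IsScalarTower k (MvPolynomial (Fin n) k) R := by
    refine IsScalarTower.of_algebraMap_eq fun b => ?_
    exact ((MvPolynomial.aeval (R := k) t).commutes b).symm
  have htow2 : IsScalarTower k (MvPolynomial (Fin n) k) (Localization.AtPrime m) := by
    refine IsScalarTower.of_algebraMap_eq fun b => ?_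
    rw [IsScalarTower.algebraMap_apply (MvPolynomial (Fin n) k) R (Localization.AtPrime m), ← IsScalarTower.algebraMap_apply k _ R, ← IsScalarTower.algebraMap_apply]
  have hFT : Algebra.FiniteType (MvPolynomial (Fin n) k) R := Algebra.FiniteType.of_restrictScalars_finiteType k _ _
  have hEFT : Algebra.EssFiniteType R (Localization.AtPrime m) := Algebra.EssFiniteType.of_isLocalization _ m.primeCompl
  have hEFT2 : Algebra.EssFiniteType (MvPolynomial (Fin n) k) (Localization.AtPrime m) := Algebra.EssFiniteType.comp _ R _
  obtain ⟨c, hc⟩ := aux_point (k := k) m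
  obtain ⟨c', hc'⟩ := aux_point_loc m c hc
  have hres : ∀ x : R, x - algebraMap (MvPolynomial (Fin n) k) R (MvPolynomial.C (c x)) ∈ m := by
    intro x
    have h1 : algebraMap (MvPolynomial (Fin n) k) R (MvPolynomial.C (c x)) = algebraMap k R (c x) :=
      (IsScalarTower.algebraMap_apply k (MvPolynomial (Fin n) k) R (c x)).symm
    rw [h1, ← hc, RingHom.mem_ker]
    simp
  have hunr : Algebra.FormallyUnramified (MvPolynomial (Fin n) k) (Localization.AtPrime m) := by
    refine aux_unram (MvPolynomial.X : Fin n → MvPolynomial (Fin n) k) ?_ ?_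
    · intro x
      refine ⟨MvPolynomial.C (c' x), ?_⟩
      have h1 : algebraMap (MvPolynomial (Fin n) k) (Localization.AtPrime m) (MvPolynomial.C (c' x)) = algebraMap k _ (c' x) :=
        (IsScalarTower.algebraMap_apply k (MvPolynomial (Fin n) k) _ (c' x)).symm
      rw [h1, IsLocalRing.mem_maximalIdeal, mem_nonunits_iff]
      intro hunit
      have := hunit.map c'
      simp at this
    · rw [← htA, Ideal.map_span, ← Set.range_comp]
      congr 2
      ext i
      rw [Function.comp_apply, ← hX, ← IsScalarTower.algebraMap_apply]
  have hfs1 : Algebra.FormallySmooth R (Localization.AtPrime m) :=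
    Algebra.FormallySmooth.of_isLocalization m.primeCompl
  have hfsA : Algebra.FormallySmooth k (Localization.AtPrime m) := Algebra.FormallySmooth.comp k R _
  have hfs : Algebra.FormallySmooth (MvPolynomial (Fin n) k) (Localization.AtPrime m) := aux_etale hΩ3
  have hflat : Module.Flat (MvPolynomial (Fin n) k) (Localization.AtPrime m) := aux_flat m
  have hmap : algebraMap (MvPolynomial (Fin n) k) (R ⧸ p) = (MvPolynomial.aeval (R := k) (fun i => Ideal.Quotient.mk p (t i))).toRingHom := by
    have : (Ideal.Quotient.mkₐ k p).comp (MvPolynomial.aeval (R := k) t) = MvPolynomial.aeval (R := k) (fun i => Ideal.Quotient.mk p (t i)) := by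
      ext i; simp
    rw [← this]; rfl
  have hIntg : Algebra.IsIntegral (MvPolynomial (Fin n) k) (R ⧸ p) := by
    constructor
    intro x
    change RingHom.IsIntegralElem _ _
    rw [hmap]; exact htint x
  have hfinite : Module.Finite (MvPolynomial (Fin n) k) (R ⧸ p) := by
    have : Algebra.FiniteType (MvPolynomial (Fin n) k) (R ⧸ p) := 
      Algebra.FiniteType.trans (S := R) inferInstance inferInstance
    exact Algebra.IsIntegral.finite
  refine aux_main_B (B := MvPolynomial (Fin n) k) m p hpm hp ?_ ?_
  · obtain ⟨b, hb, hb2⟩ := aux_surjB (B := MvPolynomial (Fin n) k) p (Ideal.span (Set.range MvPolynomial.X)) (by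
      intro x
      refine ⟨MvPolynomial.C (c x), ?_⟩
      rw [Ideal.map_span, ← Set.range_comp]
      have : (algebraMap (MvPolynomial (Fin n) k) R) ∘ MvPolynomial.X = t := by
        ext i; exact hX i
      rw [this]
      exact hm (hres x))
    refine ⟨b, ?_, hb2⟩
    intro hbm
    have h2 : algebraMap (MvPolynomial (Fin n) k) R (b - 1) ∈ m := by
      have hle : Ideal.span (Set.range (MvPolynomial.X : Fin n → MvPolynomial (Fin n) k)) ≤ m.comap (algebraMap (MvPolynomial (Fin n) k) R) := by
        rw [Ideal.span_le]; rintro _ ⟨i, rfl⟩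
        rw [SetLike.mem_coe, Ideal.mem_comap, hX]; exact htm i
      exact hle hb
    rw [map_sub, map_one] at h2
    have h3 := sub_mem hbm h2
    rw [sub_sub_cancel] at h3
    exact (inferInstance : m.IsPrime).ne_top (Ideal.eq_top_of_isUnit_mem _ h3 isUnit_one)
  · intro hbot
    have hinj : Function.Injective (algebraMap (MvPolynomial (Fin n) k) (R ⧸ p)) := by
      rw [injective_iff_map_eq_zero]
      intro x hx
      have : Ideal.Quotient.mk p (algebraMap (MvPolynomial (Fin n) k) R x) = 0 := hx
      rw [Ideal.Quotient.eq_zero_iff_mem] at this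
      have h2 : x ∈ p.comap (algebraMap (MvPolynomial (Fin n) k) R) := this
      rw [hbot] at h2
      exact h2
    have h1 := aux_dim_le hinj
    rw [hdimpoly] at h1
    have h2 : ((n + 1 : ℕ) : WithBot ℕ∞) ≤ (n : ℕ) := by
      refine le_trans ?_ hdimp
      push_cast
      gcongr
    have : n + 1 ≤ n := by exact_mod_cast h2
    omega


lemma aux_ht_le {R : Type} [CommRing R] [IsDomain R] (Q : Ideal R) [Q.IsPrime]
    (h1 : Q.height ≤ 1) (h0 : Q ≠ ⊥) : Q.height = 1 := by
  refine le_antisymm h1 ?_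
  rw [ENat.one_le_iff_ne_zero]
  intro h
  rw [Ideal.height_eq_zero_iff, IsDomain.minimalPrimes_eq_singleton_bot] at h
  exact h0 h

lemma aux_ufd {k R : Type} [Field k] [IsAlgClosed k] [CommRing R] [IsDomain R] [Algebra k R]
    [Algebra.FiniteType k R] [Algebra.FormallySmooth k R]
    (m : Ideal R) [m.IsMaximal] : UniqueFactorizationMonoid (Localization.AtPrime m) := by
  have hNR : IsNoetherianRing R := Algebra.FiniteType.isNoetherianRing k R
  have hNA : IsNoetherianRing (Localization.AtPrime m) := IsLocalization.isNoetherianRing m.primeCompl _ inferInstance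
  rw [UniqueFactorizationMonoid.iff_exists_prime_mem_of_isPrime]
  intro I hI0 hI
  obtain ⟨x, hx, hx0⟩ := Submodule.exists_mem_ne_zero_of_ne_bot hI0
  obtain ⟨Q, hQ, hQI⟩ := Ideal.exists_minimalPrimes_le (show Ideal.span {x} ≤ I by rwa [Ideal.span_singleton_le_iff_mem])
  have hQp : Q.IsPrime := hQ.1.1
  have hQ0 : Q ≠ ⊥ := by
    rintro rfl
    have := hQ.1.2 (Ideal.mem_span_singleton_self x)
    exact hx0 this
  have hQ1 : Q.height = 1 := aux_ht_le Q (Ideal.height_le_one_of_isPrincipal_of_mem_minimalPrimes _ Q hQ) hQ0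
  have h2 : (Q.under R).height = 1 := by rw [IsLocalization.height_under m.primeCompl, hQ1]
  have h3 : Q.under R ≤ m := by
    intro y hy
    have hy' : algebraMap R (Localization.AtPrime m) y ∈ Q := hy
    rw [← IsLocalization.AtPrime.to_map_mem_maximal_iff (Localization.AtPrime m) m]
    exact IsLocalRing.le_maximalIdeal hQp.ne_top hy'
  obtain ⟨g, hg⟩ := aux_main (k := k) m (Q.under R) h3 h2
  have h4 : Ideal.map (algebraMap R (Localization.AtPrime m)) (Q.under R) = Q :=
    IsLocalization.map_under m.primeCompl _ Q
  rw [h4] at hg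
  refine ⟨g, hQI (hg ▸ Ideal.mem_span_singleton_self g), ?_⟩
  rw [← Ideal.span_singleton_prime, ← hg]
  · exact hQp
  · rintro rfl
    apply hQ0; rw [hg]; simp

lemma aux_denom {R : Type} [CommRing R] [IsDomain R] [IsNoetherianRing R]
    (hufd : ∀ (m : Ideal R) [m.IsMaximal], UniqueFactorizationMonoid (Localization.AtPrime m))
    (a b : R) (hb : b ≠ 0) (P : Ideal R) [P.IsPrime] (hP : ∀ r, b ∣ r * a → r ∈ P) :
    ∃ Q : Ideal R, Q.IsPrime ∧ Q.height = 1 ∧ Q ≤ P ∧ ∀ r, b ∣ r * a → r ∈ Q := by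
  obtain ⟨m, hm, hPm⟩ := Ideal.exists_le_maximal P (Ideal.IsPrime.ne_top inferInstance)
  have := hufd m
  have hinj : Function.Injective (algebraMap R (Localization.AtPrime m)) := IsLocalization.injective _ m.primeCompl_le_nonZeroDivisors
  have hNA : IsNoetherianRing (Localization.AtPrime m) := IsLocalization.isNoetherianRing m.primeCompl _ inferInstance
  have hdis : Disjoint (m.primeCompl : Set R) (P : Set R) := by
    rw [Set.disjoint_left]; intro x hx hxp; exact hx (hPm hxp)
  have hPA : (P.map (algebraMap R (Localization.AtPrime m))).IsPrime :=
    IsLocalization.isPrime_of_isPrime_disjoint m.primeCompl _ P inferInstance hdis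
  have hcomap : (P.map (algebraMap R (Localization.AtPrime m))).under R = P :=
    IsLocalization.under_map_of_isPrime_disjoint m.primeCompl _ inferInstance hdis
  have hb' : algebraMap R (Localization.AtPrime m) b ≠ 0 := by
    rw [Ne, map_eq_zero_iff _ hinj]; exact hb
  obtain ⟨a', b', c, hrel, hca, hcb⟩ := UniqueFactorizationMonoid.exists_reduced_factors' (algebraMap R (Localization.AtPrime m) a) (algebraMap R (Localization.AtPrime m) b) hb'
  have hc0 : c ≠ 0 := by rintro rfl; simp at hcb; exact hb' hcb.symm
  have hb0 : b' ≠ 0 := by rintro rfl; simp at hcb; exact hb' hcb.symm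
  have hd : ∀ r, b ∣ r * a → b' ∣ algebraMap R (Localization.AtPrime m) r := by
    intro r hr
    have h1 := map_dvd (algebraMap R (Localization.AtPrime m)) hr
    rw [map_mul, ← hca, ← hcb, mul_left_comm, mul_dvd_mul_iff_left hc0] at h1
    exact IsRelPrime.dvd_of_dvd_mul_right hrel.symm h1
  have hbP : b' ∈ P.map (algebraMap R (Localization.AtPrime m)) := by
    obtain ⟨⟨y, σ⟩, rfl⟩ := IsLocalization.mk'_surjective m.primeCompl b'
    rw [IsLocalization.mk'_mem_iff]
    apply Ideal.mem_map_of_mem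
    have h1 : algebraMap R (Localization.AtPrime m) (y * a) ∈ Ideal.map (algebraMap R (Localization.AtPrime m)) (Ideal.span {b}) := by
      rw [Ideal.map_span, Set.image_singleton, Ideal.mem_span_singleton, map_mul, ← hca, ← hcb]
      refine ⟨algebraMap R _ σ * a', ?_⟩
      rw [← IsLocalization.mk'_spec (Localization.AtPrime m) y σ]
      ring
    rw [IsLocalization.algebraMap_mem_map_algebraMap_iff m.primeCompl] at h1
    obtain ⟨τ, hτ, h1⟩ := h1
    rw [Ideal.mem_span_singleton, ← mul_assoc] at h1
    exact ((inferInstance : P.IsPrime).mem_or_mem (hP _ h1)).resolve_left fun h => hτ (hPm h)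
  obtain ⟨f, hf, hassoc⟩ := UniqueFactorizationMonoid.exists_prime_factors b' hb0
  have hfP : f.prod ∈ P.map (algebraMap R (Localization.AtPrime m)) := Ideal.mem_of_dvd _ hassoc.symm.dvd hbP
  obtain ⟨π, hπf, hπP⟩ := (hPA.multiset_prod_mem_iff_exists_mem f).mp hfP
  have hπ := hf π hπf
  have hπb : π ∣ b' := (Multiset.dvd_prod hπf).trans hassoc.dvd
  have hπp : (Ideal.span {π}).IsPrime := (Ideal.span_singleton_prime hπ.ne_zero).mpr hπ
  refine ⟨(Ideal.span {π}).under R, inferInstance, ?_, ?_, ?_⟩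
  · rw [IsLocalization.height_under m.primeCompl]
    apply aux_ht_le
    · refine Ideal.height_le_one_of_isPrincipal_of_mem_minimalPrimes (Ideal.span {π}) _ ?_
      rw [Ideal.minimalPrimes_eq_subsingleton_self]; rfl
    · rw [Ne, Ideal.span_singleton_eq_bot]; exact hπ.ne_zero
  · rw [← hcomap]
    exact Ideal.comap_mono (by rwa [Ideal.span_singleton_le_iff_mem])
  · intro r hr
    change algebraMap R (Localization.AtPrime m) r ∈ Ideal.span {π}
    rw [Ideal.mem_span_singleton]
    exact hπb.trans (hd r hr)

lemma aux_prin {k R : Type} [Field k] [IsAlgClosed k] [CommRing R] [IsDomain R] [Algebra k R]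
    [Algebra.FiniteType k R] [Algebra.FormallySmooth k R]
    (m : Ideal R) [m.IsMaximal] (F : Finset (Ideal R)) (hF : ∀ p ∈ F, p.IsPrime ∧ p.height = 1) :
    ∃ h ∈ ∏ p ∈ F, p, ∃ g ∉ m, ∀ x ∈ ∏ p ∈ F, p, h ∣ g * x := by
  classical
  have hNR : IsNoetherianRing R := Algebra.FiniteType.isNoetherianRing k R
  have h1 : ∀ G : Finset (Ideal R), G ⊆ F → ∃ y, Ideal.map (algebraMap R (Localization.AtPrime m)) (∏ p ∈ G, p) = Ideal.span {y} := by
    intro G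
    induction G using Finset.induction_on with
    | empty => 
      intro _
      exact ⟨1, by simp [Ideal.one_eq_top, Ideal.map_top]⟩
    | insert p G hp ih => 
      intro hG
      obtain ⟨y, hy⟩ := ih ((Finset.subset_insert _ _).trans hG)
      have hpF := hF p (hG (Finset.mem_insert_self _ _))
      have := hpF.1
      have : ∃ z, Ideal.map (algebraMap R (Localization.AtPrime m)) p = Ideal.span {z} := by
        by_cases hpm : p ≤ m
        · exact aux_main (k := k) m p hpm hpF.2
        · obtain ⟨x, hxp, hxm⟩ := Set.not_subset.mp hpm
          refine ⟨1, ?_⟩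
          rw [Ideal.span_singleton_one]
          exact Ideal.eq_top_of_isUnit_mem _ (Ideal.mem_map_of_mem _ hxp) (IsLocalization.map_units (M := m.primeCompl) _ ⟨x, hxm⟩)
      obtain ⟨z, hz⟩ := this
      exact ⟨z * y, by rw [Finset.prod_insert hp, Ideal.map_mul, hz, hy, Ideal.span_singleton_mul_span_singleton]⟩
  obtain ⟨y, hy⟩ := h1 F subset_rfl
  generalize ∏ p ∈ F, p = L at *
  have hyL : y ∈ L.map (algebraMap R (Localization.AtPrime m)) := hy ▸ Ideal.mem_span_singleton_self y
  rw [IsLocalization.mem_map_algebraMap_iff m.primeCompl] at hyL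
  obtain ⟨⟨⟨h, hhL⟩, s⟩, hs⟩ := hyL
  simp only at hs
  refine ⟨h, hhL, ?_⟩
  have key : ∀ x ∈ L, ∃ g ∉ m, h ∣ g * x := by
    intro x hx
    have hx' := Ideal.mem_map_of_mem (algebraMap R (Localization.AtPrime m)) hx
    have : Ideal.span {y} = Ideal.map (algebraMap R (Localization.AtPrime m)) (Ideal.span {h}) := by
      rw [Ideal.map_span, Set.image_singleton, ← hs, Ideal.span_singleton_mul_right_unit (IsLocalization.map_units _ s)]
    rw [hy, this, IsLocalization.algebraMap_mem_map_algebraMap_iff m.primeCompl] at hx'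
    obtain ⟨g, hg, h2⟩ := hx'
    exact ⟨g, hg, Ideal.mem_span_singleton.mp h2⟩
  obtain ⟨S, hS⟩ := (IsNoetherian.noetherian L : L.FG)
  have hSL : ∀ x ∈ S, x ∈ L := fun x hx => hS ▸ Submodule.subset_span hx
  choose! g hg hgx using key
  refine ⟨∏ x ∈ S, g x, ?_, ?_⟩
  · intro hmem
    obtain ⟨x, hx, hxm⟩ := ((inferInstance : m.IsPrime).prod_mem_iff).mp hmem
    exact hg x (hSL x hx) hxm
  · intro x hx
    rw [← hS] at hx
    refine Submodule.span_induction (p := fun x _ => h ∣ (∏ x ∈ S, g x) * x) ?_ ?_ ?_ ?_ hx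
    · intro x hx
      refine (hgx x (hSL x hx)).trans ?_
      exact mul_dvd_mul_right (Finset.dvd_prod_of_mem g hx) x
    · simp
    · intro x y _ _ h1 h2
      rw [mul_add]; exact dvd_add h1 h2
    · intro a x _ h1
      rw [smul_eq_mul, mul_left_comm]; exact h1.mul_left a

open AlgebraicGeometry Opposite


abbrev GS (R : Type) [CommRing R] (U : TopologicalSpace.Opens (PrimeSpectrum R)) : Type :=
  (Spec.structureSheaf R).1.obj (op U)

noncomputable instance algGS (R : Type) [CommRing R] (U : TopologicalSpace.Opens (PrimeSpectrum R)) :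
    Algebra R (GS R U) := inferInstanceAs (Algebra R ((structureSheafInType R R).1.obj (op U)))

noncomputable def resGS {R : Type} [CommRing R] {U V : TopologicalSpace.Opens (PrimeSpectrum R)} (h : V ≤ U) :
    GS R U →+* GS R V := ((Spec.structureSheaf R).1.map (CategoryTheory.homOfLE h).op).hom

lemma resGS_alg {R : Type} [CommRing R] {U V : TopologicalSpace.Opens (PrimeSpectrum R)} (h : V ≤ U)
    (r : R) : resGS h (algebraMap R (GS R U) r) = algebraMap R (GS R V) r := by
  rfl

lemma resGS_inj {R : Type} [CommRing R] [IsDomain R] {U V : TopologicalSpace.Opens (PrimeSpectrum R)} (h : V ≤ U)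
    (hV : (V : Set (PrimeSpectrum R)).Nonempty) : Function.Injective (resGS h) := by
  have : Nonempty (V : TopologicalSpace.Opens (PrimeSpectrum R)) := hV.to_subtype
  exact @AlgebraicGeometry.map_injective_of_isIntegral (Spec (CommRingCat.of R)) _ V U
    (CategoryTheory.homOfLE h) this

lemma domGS {R : Type} [CommRing R] [IsDomain R] {U : TopologicalSpace.Opens (PrimeSpectrum R)}
    (hV : (U : Set (PrimeSpectrum R)).Nonempty) : IsDomain (GS R U) := by
  have : Nonempty (U : TopologicalSpace.Opens (PrimeSpectrum R)) := hV.to_subtype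
  exact @AlgebraicGeometry.IsIntegral.component_integral (Spec (CommRingCat.of R)) _ U this

lemma algGS_inj {R : Type} [CommRing R] [IsDomain R] {U : TopologicalSpace.Opens (PrimeSpectrum R)}
    (hV : (U : Set (PrimeSpectrum R)).Nonempty) : Function.Injective (algebraMap R (GS R U)) := by
  have h1 := resGS_inj (le_top : U ≤ ⊤) hV
  have h2 : Function.Injective (algebraMap R (GS R ⊤)) := 
    (StructureSheaf.algebraMap_obj_top_bijective (R := R)).1
  intro a b hab
  apply h2
  apply h1
  simpa only [resGS_alg] using hab

lemma awayScheme {X : Scheme} {U : X.Opens} (hU : IsCompact U.1)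
    (hU' : IsQuasiSeparated U.1) (f : Γ(X, U)) (h : IsNoetherianRing Γ(X, X.basicOpen f)) :
    IsNoetherianRing (Localization.Away f) := by
  have := isLocalization_basicOpen_of_qcqs hU hU' f
  have hEq := IsLocalization.algEquiv (.powers f) (Localization.Away f) Γ(X, X.basicOpen f)
  exact isNoetherianRing_of_ringEquiv Γ(X, X.basicOpen f) hEq.symm.toRingEquiv

lemma awayGS {R : Type} [CommRing R] [IsNoetherianRing R] (W : TopologicalSpace.Opens (PrimeSpectrum R)) (g : R)
    (h : IsNoetherianRing (GS R (W ⊓ PrimeSpectrum.basicOpen g))) :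
    IsNoetherianRing (Localization.Away (algebraMap R (GS R W) g)) := by
  let X := Spec (CommRingCat.of R)
  have hc : IsCompact (W : Set (PrimeSpectrum R)) := TopologicalSpace.NoetherianSpace.isCompact _
  have hq : IsQuasiSeparated (W : Set (PrimeSpectrum R)) := by
    intro U V _ _ _ _ _ _
    exact TopologicalSpace.NoetherianSpace.isCompact _
  have h3 := @AlgebraicGeometry.isLocalization_basicOpen_of_qcqs X W hc hq (algebraMap R (GS R W) g)
  have hb : X.basicOpen (U := W) (algebraMap R (GS R W) g) = W ⊓ PrimeSpectrum.basicOpen g := by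
    have h4 : X.basicOpen (U := W) (X.presheaf.map (CategoryTheory.homOfLE (le_top : W ≤ ⊤)).op (algebraMap R (GS R ⊤) g)) = _ := X.basicOpen_res _ _
    have h5 : X.basicOpen (U := ⊤) (algebraMap R (GS R ⊤) g) = PrimeSpectrum.basicOpen g := 
      AlgebraicGeometry.basicOpen_eq_of_affine (R := CommRingCat.of R) g
    exact h4.trans (congrArg (fun Z : TopologicalSpace.Opens (PrimeSpectrum R) => W ⊓ Z) h5)
  have h' : IsNoetherianRing (GS R (X.basicOpen (U := W) (algebraMap R (GS R W) g))) := by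
    rw [hb]; exact h
  exact awayScheme (X := X) hc hq (algebraMap R (GS R W) g) h'

lemma locGS {R : Type} [CommRing R] (f : R) :
    IsLocalization.Away f (GS R (PrimeSpectrum.basicOpen f)) :=
  StructureSheaf.IsLocalization.to_basicOpen R f

/-- Sections become regular after multiplication by a power of a function. -/
lemma denGS {R : Type} [CommRing R] [IsDomain R] {U : TopologicalSpace.Opens (PrimeSpectrum R)}
    (f : R) (hf : f ≠ 0) (hU : PrimeSpectrum.basicOpen f ≤ U) (s : GS R U) :
    ∃ (N : ℕ) (y : R), algebraMap R (GS R U) (f ^ N) * s = algebraMap R (GS R U) y := by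
  have := locGS f
  obtain ⟨⟨y, ⟨_, N, rfl⟩⟩, hy⟩ := IsLocalization.surj (Submonoid.powers f) (resGS hU s)
  refine ⟨N, y, ?_⟩
  have hne : (PrimeSpectrum.basicOpen f : Set (PrimeSpectrum R)).Nonempty :=
    ⟨⟨⊥, Ideal.isPrime_bot⟩, by simpa using hf⟩
  apply resGS_inj hU hne
  rw [map_mul, resGS_alg, resGS_alg, mul_comm]
  exact hy

lemma emptyGS {R : Type} [CommRing R] {U : TopologicalSpace.Opens (PrimeSpectrum R)}
    (hU : ¬ (U : Set (PrimeSpectrum R)).Nonempty) : IsNoetherianRing (GS R U) := by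
  have : U = ⊥ := by
    ext x
    simp [Set.not_nonempty_iff_eq_empty.1 hU]
  subst this
  have h : Subsingleton (Γ(Spec (CommRingCat.of R), ⊥)) := inferInstance
  have : Subsingleton (GS R ⊥) := h
  infer_instance

lemma surjGS {R : Type} [CommRing R] [IsDomain R] [IsNoetherianRing R]
    (hufd : ∀ (m : Ideal R) [m.IsMaximal], UniqueFactorizationMonoid (Localization.AtPrime m))
    {U : TopologicalSpace.Opens (PrimeSpectrum R)}
    (hne : (U : Set (PrimeSpectrum R)).Nonempty) (c : R)
    (hc : U ≤ PrimeSpectrum.basicOpen c)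
    (hQ : ∀ Q : PrimeSpectrum R, Q.asIdeal.height = 1 → c ∉ Q.asIdeal → Q ∈ U) :
    IsNoetherianRing (GS R U) := by
  have := locGS c
  have hN : IsNoetherianRing (GS R (PrimeSpectrum.basicOpen c)) :=
    IsLocalization.isNoetherianRing (Submonoid.powers c) _ inferInstance
  refine isNoetherianRing_of_surjective _ _ (resGS hc) ?_
  have hdom := domGS hne
  have hbasis : ∀ x ∈ U, ∃ f : R, f ∉ x.asIdeal ∧ PrimeSpectrum.basicOpen f ≤ U := by
    intro x hx
    obtain ⟨_, ⟨f, rfl⟩, hxf, hfU⟩ :=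
      PrimeSpectrum.isTopologicalBasis_basic_opens.exists_subset_of_mem_open hx U.2
    exact ⟨f, hxf, hfU⟩
  intro s
  obtain ⟨x, hx⟩ := hne
  have hne : (U : Set (PrimeSpectrum R)).Nonempty := ⟨x, hx⟩
  obtain ⟨f, hfx, hfU⟩ := hbasis x hx
  have hf0 : f ≠ 0 := by rintro rfl; exact hfx (zero_mem _)
  obtain ⟨N, a, hba⟩ := denGS f hf0 hfU s
  obtain ⟨b, hb⟩ : ∃ b, b = f ^ N := ⟨_, rfl⟩
  have hb0 : b ≠ 0 := hb ▸ pow_ne_zero _ hf0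
  rw [← hb] at hba
  have hinj := algGS_inj hne
  let d : Ideal R := (Ideal.span {b}).colon {a}
  have hd : ∀ r, r ∈ d ↔ b ∣ r * a := by
    intro r
    simp [d, Submodule.mem_colon_singleton, Ideal.mem_span_singleton]
  have hrad : c ∈ d.radical := by
    rw [Ideal.radical_eq_sInf, Submodule.mem_sInf]
    rintro P ⟨hdP, hP⟩
    by_contra hcP
    obtain ⟨Q, hQp, hQ1, hQP, hdQ⟩ := aux_denom hufd a b hb0 P (fun r hr => hdP ((hd r).2 hr))
    have hQU := hQ ⟨Q, hQp⟩ hQ1 (fun h => hcP (hQP h))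
    obtain ⟨f', hf', hfU'⟩ := hbasis _ hQU
    have hf0' : f' ≠ 0 := by rintro rfl; exact hf' (zero_mem _)
    obtain ⟨N', y, hy⟩ := denGS f' hf0' hfU' s
    have : f' ^ N' ∈ Q := by
      apply hdQ
      refine ⟨y, ?_⟩
      apply hinj
      rw [map_mul, map_mul, ← hy, ← hba]
      ring
    exact hf' (hQp.mem_of_pow_mem _ this)
  obtain ⟨n, hn⟩ := hrad
  obtain ⟨y, hy⟩ := (hd _).1 hn
  refine ⟨IsLocalization.mk' _ y (⟨c ^ n, n, rfl⟩ : Submonoid.powers c), ?_⟩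
  have h1 := congrArg (resGS hc) (IsLocalization.mk'_spec (GS R (PrimeSpectrum.basicOpen c)) y
    (⟨c ^ n, n, rfl⟩ : Submonoid.powers c))
  rw [map_mul, resGS_alg, resGS_alg] at h1
  have hc0 : c ≠ 0 := by rintro rfl; exact hc hx (zero_mem _)
  have hz : algebraMap R (GS R U) (b * c ^ n) ≠ 0 := by
    rw [Ne, map_eq_zero_iff _ hinj]
    exact mul_ne_zero hb0 (pow_ne_zero _ hc0)
  apply mul_left_cancel₀ hz
  have h2 := congrArg (algebraMap R (GS R U)) hy
  simp only [map_mul] at h1 h2 ⊢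
  linear_combination (algebraMap R (GS R U) b) * h1 - (algebraMap R (GS R U) (c ^ n)) * hba - h2

lemma localGS {k R : Type} [Field k] [IsAlgClosed k] [CommRing R] [IsDomain R] [Algebra k R]
    [Algebra.FiniteType k R] [Algebra.FormallySmooth k R] [IsNoetherianRing R]
    (W : TopologicalSpace.Opens (PrimeSpectrum R)) (m : Ideal R) [m.IsMaximal] :
    ∃ g ∉ m, IsNoetherianRing (GS R (W ⊓ PrimeSpectrum.basicOpen g)) := by
  by_cases hW : (W : Set (PrimeSpectrum R)).Nonempty
  swap
  · refine ⟨1, fun h => Ideal.IsMaximal.ne_top ‹_› ((Ideal.eq_top_iff_one m).2 h), emptyGS ?_⟩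
    exact fun ⟨x, hx⟩ => hW ⟨x, hx.1⟩
  let I := PrimeSpectrum.vanishingIdeal (W : Set (PrimeSpectrum R))ᶜ
  have hI : ∀ x : PrimeSpectrum R, x ∉ W ↔ I ≤ x.asIdeal := by
    intro x
    have h1 : PrimeSpectrum.zeroLocus (I : Set R) = (W : Set (PrimeSpectrum R))ᶜ := by
      rw [PrimeSpectrum.zeroLocus_vanishingIdeal_eq_closure]
      exact W.2.isClosed_compl.closure_eq
    have h2 := Set.ext_iff.1 h1 x
    exact h2.symm
  have hI0 : I ≠ ⊥ := by
    intro h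
    obtain ⟨x, hx⟩ := hW
    have : (⟨⊥, Ideal.isPrime_bot⟩ : PrimeSpectrum R) ∈ W := by
      refine (PrimeSpectrum.le_iff_specializes _ x).1 ?_ |>.mem_open W.2 hx
      exact (bot_le : (⊥ : Ideal R) ≤ x.asIdeal)
    exact (hI _).2 h.le this
  have hfin : {p ∈ I.minimalPrimes | p.height = 1}.Finite :=
    (Ideal.finite_minimalPrimes_of_isNoetherianRing R I).subset (fun p hp => hp.1)
  obtain ⟨h, hh, g, hg, hdiv⟩ := aux_prin (k := k) m hfin.toFinset
    (fun p hp => by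
      rw [Set.Finite.mem_toFinset] at hp
      exact ⟨hp.1.1.1, hp.2⟩)
  refine ⟨g, hg, ?_⟩
  by_cases hU : ((W ⊓ PrimeSpectrum.basicOpen g : TopologicalSpace.Opens (PrimeSpectrum R)) :
      Set (PrimeSpectrum R)).Nonempty
  swap
  · exact emptyGS hU
  refine surjGS (fun m _ => aux_ufd (k := k) m) hU (g * h) ?_ ?_
  · rintro x ⟨hxW, hxg⟩ hgh
    have hxg' : g ∉ x.asIdeal := hxg
    have hhx : h ∈ x.asIdeal := (x.2.mem_or_mem hgh).resolve_left hxg'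
    have hle : ∏ p ∈ hfin.toFinset, p ≤ x.asIdeal := by
      intro y hy
      exact (x.2.mem_or_mem (x.asIdeal.mem_of_dvd (hdiv y hy) hhx)).resolve_left hxg'
    obtain ⟨p, hp, hpx⟩ := (x.2.prod_le).1 hle
    rw [Set.Finite.mem_toFinset] at hp
    exact (hI x).2 (hp.1.1.2.trans hpx) hxW
  · intro Q hQ1 hQ
    have hgQ : g ∉ Q.asIdeal := fun h' => hQ (Ideal.mul_mem_right _ _ h')
    have hhQ : h ∉ Q.asIdeal := fun h' => hQ (Ideal.mul_mem_left _ _ h')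
    refine ⟨?_, hgQ⟩
    by_contra hQW
    apply hhQ
    have hIQ := (hI Q).1 hQW
    have hmem : Q.asIdeal ∈ hfin.toFinset := by
      rw [Set.Finite.mem_toFinset]
      refine ⟨⟨⟨Q.2, hIQ⟩, ?_⟩, hQ1⟩
      rintro P ⟨hP, hIP⟩ hPQ
      by_contra hne
      have hlt : P < Q.asIdeal := lt_of_le_not_ge hPQ hne
      have := Q.2
      have := aux_ht_one Q.asIdeal P hQ1 hlt
      exact hI0 (le_bot_iff.1 (this ▸ hIP))
    exact (Ideal.prod_le_inf.trans (Finset.inf_le hmem)) hh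

theorem mainGS {k R : Type} [Field k] [IsAlgClosed k] [CommRing R] [IsDomain R] [Algebra k R]
    [Algebra.FiniteType k R] [Algebra.FormallySmooth k R]
    (W : TopologicalSpace.Opens (PrimeSpectrum R)) : IsNoetherianRing (GS R W) := by
  have : IsNoetherianRing R := Algebra.FiniteType.isNoetherianRing k R
  let T : Set R := {g | IsNoetherianRing (GS R (W ⊓ PrimeSpectrum.basicOpen g))}
  have hT : Ideal.span T = ⊤ := by
    by_contra hne
    obtain ⟨m, hm, hTm⟩ := Ideal.exists_le_maximal _ hne
    obtain ⟨g, hg, hgN⟩ := localGS (k := k) W m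
    exact hg (hTm (Ideal.subset_span hgN))
  obtain ⟨F, hFT, hF⟩ := (Ideal.span_eq_top_iff_finite T).1 hT
  classical
  refine isNoetherianRing_of_away (F.image (algebraMap R (GS R W))) ?_ ?_
  · rw [Finset.coe_image, ← Ideal.map_span, hF, Ideal.map_top]
  · rintro ⟨_, hx⟩
    obtain ⟨g, hg, rfl⟩ := Finset.mem_image.1 hx
    exact awayGS W g (hFT hg)


/-- **Noetherianity of rings of regular functions on Zariski opens of a smooth affine
variety.**  Let `X = Spec R` be a smooth affine complex algebraic variety and `W` a Zariski
open subset of `X`.  Then the ring `O_X(W)` of regular functions on `W` is Noetherian. -/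
theorem sections_noetherian (R : Type) [CommRing R] [IsDomain R] [Algebra ℂ R]
    [Algebra.FiniteType ℂ R] [Algebra.FormallySmooth ℂ R]
    (W : TopologicalSpace.Opens (PrimeSpectrum R)) :
    IsNoetherianRing ((Spec.structureSheaf R).1.obj (op W)) := by
  exact mainGS (k := ℂ) W
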